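/- arXiv:2011.00683 — 2 statements merged into one kernel-verified Lean document; each statement's English description precedes it below -/
import Mathlib

section
/- There exists a tournament on 33 vertices containing no transitive subtournament of size 7. Consequently the directed Ramsey number R(7) satisfies R(7) ≥ 34. -/
/-- A tournament: an irreflexive relation such that for distinct vertices
exactly one direction of the edge is present. -/
def IsTournament {V : Type*} (r : V → V → Prop) : Prop :=
  (∀ v, ¬ r v v) ∧ ∀ u v : V, u ≠ v → Xor' (r u v) (r v u)

/-- The tournament `r` contains a transitive subtournament of size `k`. -/
def HasTT {V : Type*} (r : V → V → Prop) (k : ℕ) : Prop :=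
  ∃ f : Fin k → V, Function.Injective f ∧ ∀ i j : Fin k, i < j → r (f i) (f j)

/-- The directed Ramsey number: the least `n` such that every tournament on
`n` vertices contains a transitive subtournament of size `k`. -/
noncomputable def directedRamsey (k : ℕ) : ℕ :=
  sInf {n : ℕ | ∀ r : Fin n → Fin n → Prop, IsTournament r → HasTT r k}

/-- The adjacency matrix of a tournament on 33 vertices, packed row by row into the bits of a
number. The tournament is invariant under an action of `ℤ/3 × ℤ/3`. -/
def adjBits : ℕ :=
  1645294521059095364735824584979406007412052341845694258674766520721308458549457165064856151057425913605284422987976696977883916859568303351388576107669038239909439003584743533630470601546823334234497859123748810637675185000356595023718054666338773953803484565391053104916419561607835717568514990864059020353229833345213880764770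

/-- Bit `33 * u + v` of `adjBits`: whether `u` dominates `v`. -/
def adj33 (u v : ℕ) : Bool := adjBits.testBit (33 * u + v)

/-- Exhaustive search verifying that no transitive subtournament of size `k` of the relation `r`
has all its vertices in the list `l`. -/
def noTTIn {α : Type*} (r : α → α → Bool) : ℕ → List α → Bool
  | 0, _ => false
  | k + 1, l => l.all fun v => noTTIn r k (l.filter (r v))

theorem not_transitive_of_noTTIn {α : Type*} (r : α → α → Bool) (k : ℕ) (l : List α)
    (h : noTTIn r k l = true) (f : Fin k → α) (hl : ∀ i, f i ∈ l) :
    ¬ ∀ i j, i < j → r (f i) (f j) = true := by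
  induction k generalizing l with
  | zero => simp [noTTIn] at h
  | succ k ih =>
    intro hf
    simp only [noTTIn, List.all_eq_true] at h
    refine ih _ (h _ (hl 0)) (fun i => f i.succ) (fun i => ?_) fun i j hij => ?_
    · exact List.mem_filter.2 ⟨hl _, hf _ _ (Fin.succ_pos i)⟩
    · exact hf _ _ (Fin.succ_lt_succ_iff.2 hij)

theorem noTTIn_adj33 : noTTIn adj33 7 (List.range 33) = true := by
  decide +kernel

theorem isTournament_adj33 :
    IsTournament fun u v : Fin 33 => adj33 u v = true := by
  unfold IsTournament Xor'
  decide +kernel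

theorem not_hasTT_adj33 : ¬ HasTT (fun u v : Fin 33 => adj33 u v = true) 7 := by
  rintro ⟨f, -, hf⟩
  exact not_transitive_of_noTTIn adj33 7 _ noTTIn_adj33 (fun i => (f i : ℕ))
    (fun i => List.mem_range.2 (f i).isLt) hf

/-- Every set of at least `2 ^ k` vertices of a tournament contains a transitive subtournament
of size `k + 1`. -/
theorem IsTournament.exists_transitive {V : Type*} {r : V → V → Prop} (hr : IsTournament r)
    (k : ℕ) (S : Finset V) (hS : 2 ^ k ≤ S.card) :
    ∃ f : Fin (k + 1) → V, (∀ i, f i ∈ S) ∧ ∀ i j, i < j → r (f i) (f j) := by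
  classical
  induction k generalizing S with
  | zero =>
    obtain ⟨v, hv⟩ := Finset.card_pos.1 (by simpa using hS)
    exact ⟨fun _ => v, fun _ => hv, fun i j hij => by omega⟩
  | succ k ih =>
    obtain ⟨v, hv⟩ : S.Nonempty := Finset.card_pos.1 (lt_of_lt_of_le (by positivity) hS)
    have hcard := Finset.card_erase_of_mem hv
    have hsplit := Finset.card_filter_add_card_filter_not (s := S.erase v) (r v)
    have hpow : 2 ^ (k + 1) = 2 * 2 ^ k := by ring
    by_cases hout : 2 ^ k ≤ ((S.erase v).filter (r v)).card
    · obtain ⟨f, hf, hlt⟩ := ih _ hout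
      simp only [Finset.mem_filter, Finset.mem_erase] at hf
      refine ⟨Fin.cons v f, fun i => ?_, fun i j hij => ?_⟩
      · cases i using Fin.cases with
        | zero => exact hv
        | succ i => exact (hf i).1.2
      · cases j using Fin.cases with
        | zero => simp at hij
        | succ j =>
          cases i using Fin.cases with
          | zero => exact (hf j).2
          | succ i => exact hlt i j (Fin.succ_lt_succ_iff.1 hij)
    · obtain ⟨f, hf, hlt⟩ := ih ((S.erase v).filter fun u => ¬ r v u) (by omega)
      simp only [Finset.mem_filter, Finset.mem_erase] at hf
      have hin (i) : r (f i) v := by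
        rcases hr.2 v (f i) (hf i).1.1.symm with h | h
        · exact absurd h.1 (hf i).2
        · exact h.1
      refine ⟨Fin.snoc f v, fun i => ?_, fun i j hij => ?_⟩
      · cases i using Fin.lastCases with
        | last => simpa using hv
        | cast i => simpa using (hf i).1.2
      · cases i using Fin.lastCases with
        | last => exact absurd hij (Fin.le_last j).not_gt
        | cast i =>
          cases j using Fin.lastCases with
          | last => simpa using hin i
          | cast j => simpa using hlt i j (by simpa using hij)

theorem IsTournament.hasTT_of_two_pow_le_card {V : Type*} [Fintype V] {r : V → V → Prop}
    (hr : IsTournament r) (k : ℕ) (hV : 2 ^ k ≤ Fintype.card V) : HasTT r (k + 1) := by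
  obtain ⟨f, -, hf⟩ := hr.exists_transitive k Finset.univ hV
  refine ⟨f, fun i j hij => ?_, hf⟩
  by_contra hne
  rcases lt_or_gt_of_ne hne with h | h
  · exact hr.1 (f j) (hij ▸ hf i j h)
  · exact hr.1 (f j) (hij ▸ hf j i h)

theorem IsTournament.comap {V W : Type*} {r : V → V → Prop} (hr : IsTournament r)
    {g : W → V} (hg : Function.Injective g) : IsTournament fun u v => r (g u) (g v) :=
  ⟨fun v => hr.1 (g v), fun _ _ huv => hr.2 _ _ (hg.ne huv)⟩

theorem HasTT.of_comap {V W : Type*} {r : V → V → Prop} {g : W → V}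
    (hg : Function.Injective g) {k : ℕ} (h : HasTT (fun u v => r (g u) (g v)) k) :
    HasTT r k := by
  obtain ⟨f, hf, hlt⟩ := h
  exact ⟨g ∘ f, hg.comp hf, hlt⟩

theorem lt_directedRamsey {n k : ℕ} {r : Fin n → Fin n → Prop} (hr : IsTournament r)
    (hk : ¬ HasTT r (k + 1)) : n < directedRamsey (k + 1) := by
  have hne : {m : ℕ | ∀ r : Fin m → Fin m → Prop, IsTournament r → HasTT r (k + 1)}.Nonempty :=
    ⟨2 ^ k, fun r hr => hr.hasTT_of_two_pow_le_card k (by simp)⟩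
  by_contra! hle
  have hinj := Fin.castLE_injective hle
  exact hk (HasTT.of_comap hinj (Nat.sInf_mem hne _ (hr.comap hinj)))

theorem R7_lower_bound :
    (∃ r : Fin 33 → Fin 33 → Prop, IsTournament r ∧ ¬ HasTT r 7) ∧
      34 ≤ directedRamsey 7 := by
  exact ⟨⟨_, isTournament_adj33, not_hasTT_adj33⟩,
    lt_directedRamsey isTournament_adj33 not_hasTT_adj33⟩
end

section
/- Every TT_6-free tournament on 25 vertices is a subtournament of some TT_6-free tournament on 27 vertices; that is, for every tournament on Fin 25 containing no transitive subtournament of size 6, there exists a tournament on Fin 27 containing no transitive subtournament of size 6 and an injective map from Fin 25 to Fin 27 preserving the edge relation. -/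
namespace TournamentExtension

universe u

/-! ### Evaluation helpers -/

/-- `k n`, arranged so that the kernel evaluates `n` to a numeral before unfolding `k`. -/
noncomputable def force {α : Sort u} (n : ℕ) (k : ℕ → α) : α :=
  Nat.rec (motive := fun _ => α) (k 0) (fun m _ => k (Nat.succ m)) n

@[simp] theorem force_eq {α : Sort u} (n : ℕ) (k : ℕ → α) : force n k = k n := by
  cases n <;> rfl

/-- A conditional on Booleans, given by the bare recursor. -/
noncomputable def sel {α : Sort u} (b : Bool) (x y : α) : α :=
  Bool.rec (motive := fun _ => α) y x b

@[simp] theorem sel_true {α : Sort u} (x y : α) : sel true x y = x := rfl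

@[simp] theorem sel_false {α : Sort u} (x y : α) : sel false x y = y := rfl

theorem nat_ops (m n : ℕ) : Nat.add m n = m + n ∧ Nat.sub m n = m - n ∧ Nat.mul m n = m * n ∧
    Nat.div m n = m / n ∧ Nat.mod m n = m % n ∧ Nat.pow m n = m ^ n ∧ Nat.land m n = m &&& n ∧
    Nat.lor m n = m ||| n ∧ Nat.xor m n = m ^^^ n ∧ Nat.shiftLeft m n = m <<< n ∧
    Nat.shiftRight m n = m >>> n :=
  ⟨rfl, rfl, rfl, rfl, rfl, rfl, rfl, rfl, rfl, rfl, rfl⟩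

/-- The `i`-th binary digit of `n`. -/
noncomputable def bit (n i : ℕ) : Bool := Nat.beq (Nat.mod (Nat.shiftRight n i) 2) 1

@[simp] theorem bit_eq (n i : ℕ) : bit n i = n.testBit i := by
  rw [Bool.eq_iff_iff, bit, Nat.beq_eq, Nat.testBit_eq_decide_div_mod_eq, decide_eq_true_iff]
  rw [← Nat.shiftRight_eq_div_pow]; rfl

/-! ### Transitive chains in a tournament given by rows of bits -/

/-- The rows of bits in blocks of 32 digits. -/
noncomputable def blocks (rows : List ℕ) : ℕ :=
  List.rec (motive := fun _ => ℕ) 0 (fun row _ ih => Nat.lor row (Nat.shiftLeft ih 32)) rows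

/-- The rows of bits in blocks of 32 digits, above a block of 64 digits which makes the low digits
of different values differ: the kernel hashes numerals by these. -/
noncomputable def pack (rows : List ℕ) : ℕ :=
  force (blocks rows) fun R =>
    Nat.lor (Nat.mod R 2305843009213693951) (Nat.shiftLeft R 64)

/-- Some digit `x < n` of `T` satisfies `p (S ∩ row x)`, for the rows packed in `R`. -/
noncomputable def scan (p : ℕ → Bool) (R S n : ℕ) : ℕ → Bool :=
  Nat.rec (motive := fun _ => ℕ → Bool) (fun _ => false)
    (fun _ ih T => sel (Nat.beq T 0) false (force (Nat.log2 T) fun i =>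
      sel (force (Nat.land S (Nat.shiftRight R (Nat.add 64 (Nat.mul 32 i)))) p) true
        (force (Nat.xor T (Nat.pow 2 i)) ih))) n

/-- Whether the digits of `S` contain a transitive chain of length `k`,
where `i → j` iff the `j`-th digit of the `i`-th row is set. -/
noncomputable def hasChainIn (rows : List ℕ) (k S : ℕ) : Bool :=
  force (pack rows) fun R => force rows.length fun n =>
    Nat.rec (motive := fun _ => ℕ → Bool) (fun _ => true) (fun _ ih S => scan ih R S n S) k S

/-- Whether the tournament given by `rows` contains a transitive chain of length `k`. -/
noncomputable def hasChain (rows : List ℕ) (k : ℕ) : Bool :=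
  force (Nat.sub (Nat.pow 2 rows.length) 1) fun S => hasChainIn rows k S

theorem testBit_blocks {rows : List ℕ} (h : ∀ row ∈ rows, row < 2 ^ 32) (i : ℕ) {j : ℕ}
    (hj : j < 32) : (blocks rows >>> (32 * i)).testBit j = (rows.getD i 0).testBit j := by
  induction rows generalizing i with
  | nil => simp [blocks]
  | cons row tl ih =>
    have key : blocks (row :: tl) = row ||| blocks tl <<< 32 := rfl
    rw [key, Nat.testBit_shiftRight, Nat.testBit_or, Nat.testBit_shiftLeft]
    cases i with
    | zero => simp [show ¬ 32 ≤ j by omega]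
    | succ i =>
      rw [Nat.testBit_lt_two_pow ((h row (by simp)).trans_le (Nat.pow_le_pow_right two_pos
        (show 32 ≤ 32 * (i + 1) + j by omega)))]
      have := ih (fun row hrow => h row (by simp [hrow])) i
      rw [Nat.testBit_shiftRight] at this
      simp only [Bool.false_or, List.getD_cons_succ, ← this,
        show 32 ≤ 32 * (i + 1) + j by omega, decide_true, Bool.true_and,
        show 32 * (i + 1) + j - 32 = 32 * i + j by omega]

theorem testBit_pack {rows : List ℕ} (h : ∀ row ∈ rows, row < 2 ^ 32) (i : ℕ) {j : ℕ}
    (hj : j < 32) : (pack rows >>> (64 + 32 * i)).testBit j = (rows.getD i 0).testBit j := by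
  have key : pack rows = blocks rows % 2305843009213693951 ||| blocks rows <<< 64 := by
    simp only [pack, force_eq, nat_ops]
  have hlt : blocks rows % 2305843009213693951 < 2 ^ 64 :=
    (Nat.mod_lt _ (by norm_num)).trans (by norm_num)
  have := testBit_blocks h i hj
  rw [Nat.testBit_shiftRight] at this
  rw [key, Nat.testBit_shiftRight, Nat.testBit_or, Nat.testBit_shiftLeft, ← this,
    Nat.testBit_lt_two_pow (hlt.trans_le (Nat.pow_le_pow_right two_pos (by omega)))]
  simp [show 64 ≤ 64 + 32 * i + j by omega, show 64 + 32 * i + j - 64 = 32 * i + j by omega]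

theorem scan_iff (p : ℕ → Bool) (R S : ℕ) {n T : ℕ} (hT : T < 2 ^ n) :
    scan p R S n T = true ↔
      ∃ x, T.testBit x = true ∧ p (S &&& R >>> (64 + 32 * x)) = true := by
  induction n generalizing T with
  | zero =>
    obtain rfl : T = 0 := by simpa using hT
    simp [scan]
  | succ n ih =>
    have key : scan p R S (n + 1) T = sel (Nat.beq T 0) false
        (sel (p (S &&& R >>> (64 + 32 * Nat.log2 T))) true
          (scan p R S n (T ^^^ 2 ^ Nat.log2 T))) := by
      unfold scan
      simp only [force_eq, nat_ops]
    rw [key]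
    cases h0 : Nat.beq T 0 with
    | true =>
      obtain rfl := Nat.eq_of_beq_eq_true h0
      simp
    | false =>
      have hne : T ≠ 0 := fun h => by simp [h] at h0
      have htop : T.testBit T.log2 = true := Nat.testBit_log2 hne
      have hbit : ∀ x, (T ^^^ 2 ^ T.log2).testBit x = true ↔ x ≠ T.log2 ∧ T.testBit x = true := by
        intro x
        rw [Nat.testBit_xor, Nat.testBit_two_pow]
        rcases eq_or_ne x T.log2 with rfl | hx
        · simp [htop]
        · simp [hx, hx.symm]
      have hlt : T ^^^ 2 ^ T.log2 < 2 ^ n := by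
        refine Nat.lt_pow_two_of_testBit _ fun i hi => ?_
        rw [← Bool.not_eq_true, hbit]
        rintro ⟨h1, h2⟩
        have h3 := Nat.ge_two_pow_of_testBit h2
        have h4 := (Nat.le_log2 hne).2 h3
        have h5 := (Nat.log2_lt hne).2 hT
        omega
      rw [sel_false]
      cases hp : p (S &&& R >>> (64 + 32 * T.log2)) with
      | true => exact ⟨fun _ => ⟨_, htop, hp⟩, fun _ => rfl⟩
      | false =>
        rw [sel_false, ih hlt]
        constructor
        · rintro ⟨x, hx, h⟩
          exact ⟨x, ((hbit x).1 hx).2, h⟩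
        · rintro ⟨x, hx, h⟩
          refine ⟨x, (hbit x).2 ⟨?_, hx⟩, h⟩
          rintro rfl
          rw [hp] at h
          exact absurd h (by simp)

theorem hasChainIn_iff {rows : List ℕ} (hlen : rows.length ≤ 32) (h : ∀ row ∈ rows, row < 2 ^ 32)
    (k : ℕ) {S : ℕ} (hS : S < 2 ^ rows.length) :
    hasChainIn rows k S = true ↔ ∃ l : List ℕ, l.length = k ∧
      (∀ x ∈ l, S.testBit x = true) ∧
      l.Pairwise fun x y => (rows.getD x 0).testBit y = true := by
  induction k generalizing S with
  | zero =>
    simp only [List.length_eq_zero_iff, hasChainIn, force_eq]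
    exact ⟨fun _ => ⟨[], rfl, by simp, .nil⟩, fun _ => rfl⟩
  | succ k ih =>
    have key : hasChainIn rows (k + 1) S =
        scan (fun S => hasChainIn rows k S) (pack rows) S rows.length S := by
      unfold hasChainIn
      simp only [force_eq]
    have hbound : ∀ {T : ℕ}, S &&& T < 2 ^ rows.length := Nat.and_le_left.trans_lt hS
    have hlt : ∀ {x}, S.testBit x = true → x < 32 := fun {x} hx =>
      ((Nat.pow_lt_pow_iff_right one_lt_two).1
        ((Nat.ge_two_pow_of_testBit hx).trans_lt hS)).trans_le hlen
    have hmem : ∀ {x y}, (S &&& pack rows >>> (64 + 32 * x)).testBit y = true ↔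
        S.testBit y = true ∧ (rows.getD x 0).testBit y = true := by
      intro x y
      rw [Nat.testBit_and, Bool.and_eq_true]
      exact and_congr_right fun hy => by rw [testBit_pack h _ (hlt hy)]
    rw [key, scan_iff _ _ _ hS]
    constructor
    · rintro ⟨x, hx, hc⟩
      obtain ⟨l, hl, hm, hp⟩ := (ih hbound).1 hc
      refine ⟨x :: l, by simp [hl], ?_, List.pairwise_cons.2 ⟨fun y hy => (hmem.1 (hm y hy)).2, hp⟩⟩
      rintro y hy
      rcases List.mem_cons.1 hy with rfl | hy
      exacts [hx, (hmem.1 (hm y hy)).1]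
    · rintro ⟨l, hl, hm, hp⟩
      cases l with
      | nil => simp at hl
      | cons x l =>
        rw [List.pairwise_cons] at hp
        exact ⟨x, hm x (by simp), (ih hbound).2 ⟨l, by simpa using hl,
          fun y hy => hmem.2 ⟨hm y (by simp [hy]), hp.1 y hy⟩, hp.2⟩⟩

section

variable {V : Type*}

/-- The set `S` contains no transitive chain of length `k`. -/
def ChainFree (r : V → V → Prop) (k : ℕ) (S : Set V) : Prop :=
  ∀ l : List V, l.length = k → l.Pairwise r → ¬ ∀ x ∈ l, x ∈ S

/-- The digits of `m` record which entries of `vs` are beaten by `v`. -/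
def IsRow (r : V → V → Prop) (m : ℕ) (v : V) (vs : List V) : Prop :=
  ∀ j, m.testBit j = true ↔ ∃ w, vs[j]? = some w ∧ r v w

/-- The rows of bits describe the relation `r` on the list `vs`. -/
def IsModel (r : V → V → Prop) (rows : List ℕ) (vs : List V) : Prop :=
  List.Forall₂ (fun m v => IsRow r m v vs) rows vs

theorem IsRow.lt {r : V → V → Prop} {m : ℕ} {v : V} {vs : List V} (h : IsRow r m v vs) :
    m < 2 ^ vs.length := by
  refine Nat.lt_pow_two_of_testBit _ fun i hi => ?_
  rw [← Bool.not_eq_true, h i]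
  rintro ⟨w, hw, -⟩
  rw [List.getElem?_eq_none hi] at hw
  exact absurd hw (by simp)

theorem IsModel.hasChainIn_eq_false {r : V → V → Prop} {rows : List ℕ} {vs : List V}
    (hm : IsModel r rows vs) (hlen : vs.length ≤ 32) {k S : ℕ} (hS : S < 2 ^ vs.length) {X : Set V}
    (hX : ∀ (i : ℕ) (hi : i < vs.length), S.testBit i = true → vs[i] ∈ X) (h : ChainFree r k X) :
    hasChainIn rows k S = false := by
  have hl := hm.length_eq
  have hrows : ∀ row ∈ rows, row < 2 ^ 32 := by
    intro row hrow
    obtain ⟨i, hi, rfl⟩ := List.getElem_of_mem hrow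
    have := (hm.get hi (by omega)).lt
    simp only [List.get_eq_getElem] at this
    exact this.trans_le (Nat.pow_le_pow_right two_pos hlen)
  rw [← Bool.not_eq_true, hasChainIn_iff (by omega) hrows _ (by rwa [hl])]
  rintro ⟨l, hl', hlt, hp⟩
  have hlt' : ∀ x ∈ l, x < vs.length := fun x hx =>
    (Nat.pow_lt_pow_iff_right one_lt_two).1 ((Nat.ge_two_pow_of_testBit (hlt x hx)).trans_lt hS)
  refine h (l.pmap (fun x hx => vs[x]) hlt') (by simpa using hl') ?_ ?_
  · rw [List.pairwise_pmap]
    refine hp.imp_of_mem fun {a b} ha hb hab hi hj => ?_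
    have hrow := hm.get (i := a) (by omega) hi
    simp only [List.get_eq_getElem] at hrow
    rw [List.getD_eq_getElem _ _ (by omega)] at hab
    obtain ⟨w, hw, hr⟩ := (hrow b).1 hab
    rw [List.getElem?_eq_getElem hj, Option.some_inj] at hw
    exact hw ▸ hr
  · intro x hx
    obtain ⟨a, ha, rfl⟩ := List.mem_pmap.1 hx
    exact hX _ _ (hlt a ha)

theorem IsModel.hasChain_eq_false {r : V → V → Prop} {rows : List ℕ} {vs : List V}
    (hm : IsModel r rows vs) (hlen : vs.length ≤ 32) {k : ℕ} {X : Set V} (hX : ∀ x ∈ vs, x ∈ X)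
    (h : ChainFree r k X) : hasChain rows k = false := by
  rw [hasChain, force_eq, hm.length_eq]
  exact hm.hasChainIn_eq_false hlen (Nat.sub_lt (Nat.two_pow_pos _) one_pos)
    (fun i hi _ => hX _ (List.getElem_mem hi)) h

theorem IsRow.snoc_of_rel {r : V → V → Prop} {m : ℕ} {v w : V} {vs : List V}
    (h : IsRow r m v vs) (hw : r v w) : IsRow r (m ||| 2 ^ vs.length) v (vs ++ [w]) := by
  intro j
  rw [Nat.testBit_or, Bool.or_eq_true, h j, Nat.testBit_two_pow, decide_eq_true_iff]
  rcases lt_trichotomy j vs.length with hj | rfl | hj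
  · simp [List.getElem?_append, hj, hj.ne']
  · simp [hw]
  · have : ¬ j < vs.length := by omega
    have h2 : ([w] : List V)[j - vs.length]? = none := by simp; omega
    simp [List.getElem?_append, this, h2, hj.ne]

theorem IsRow.snoc_of_not_rel {r : V → V → Prop} {m : ℕ} {v w : V} {vs : List V}
    (h : IsRow r m v vs) (hw : ¬ r v w) : IsRow r m v (vs ++ [w]) := by
  intro j
  rw [h j]
  rcases lt_trichotomy j vs.length with hj | rfl | hj
  · simp [List.getElem?_append, hj]
  · simp [hw]
  · have : ¬ j < vs.length := by omega
    have h2 : ([w] : List V)[j - vs.length]? = none := by simp; omega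
    simp [List.getElem?_append, this, h2]

/-- Adjoin a vertex with row `m` to a tournament, where `e` is `2` to the number of vertices;
the digits of `T` tell which rows are beaten by the new vertex. -/
noncomputable def extend (m e : ℕ) (rows : List ℕ) : ℕ → (List ℕ → Bool) → Bool :=
  List.rec (motive := fun _ => ℕ → (List ℕ → Bool) → Bool) (fun _ k => k [m])
    (fun row _ ih T k => force (Nat.div T 2) fun T' =>
      force (sel (Nat.beq (Nat.mod T 2) 0) (Nat.lor row e) row) fun row' =>
        ih T' fun l => k (row' :: l)) rows

theorem extend_eq (m : ℕ) {r : V → V → Prop} (hr : IsTournament r) {rows : List ℕ}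
    {vs : List V} (hm : IsModel r rows vs) {w : V} (hw : w ∉ vs) (hrow : IsRow r m w vs)
    (k : List ℕ → Bool) :
    ∃ rows', IsModel r rows' (vs ++ [w]) ∧ extend m (2 ^ vs.length) rows m k = k rows' := by
  have aux : ∀ (l : List ℕ) (us : List V) (T : ℕ) (k : List ℕ → Bool),
      List.Forall₂ (fun m v => IsRow r m v vs) l us → (∀ u ∈ us, u ≠ w) → IsRow r T w us →
      ∃ l', List.Forall₂ (fun m v => IsRow r m v (vs ++ [w])) l' us ∧
        extend m (2 ^ vs.length) l T k = k (l' ++ [m]) := by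
    intro l us T k h
    induction h generalizing T k with
    | nil => exact fun _ _ => ⟨[], .nil, rfl⟩
    | @cons row u l us hu hl ih =>
      intro hne hT
      have h0 : T % 2 = 1 ↔ r w u := by
        have := hT 0
        simpa [Nat.testBit_zero] using this
      have hT' : IsRow r (T / 2) w us := fun j => by
        have := hT (j + 1)
        simpa [Nat.testBit_succ] using this
      have key : extend m (2 ^ vs.length) (row :: l) T k = extend m (2 ^ vs.length) l (T / 2)
          fun l' => k (sel (Nat.beq (T % 2) 0) (row ||| 2 ^ vs.length) row :: l') := by
        unfold extend
        simp only [force_eq, nat_ops]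
      obtain ⟨l', hl', he⟩ := ih (T / 2)
        (fun l' => k (sel (Nat.beq (T % 2) 0) (row ||| 2 ^ vs.length) row :: l'))
        (fun u hu => hne u (by simp [hu])) hT'
      refine ⟨_ :: l', .cons ?_ hl', by rw [key, he]; rfl⟩
      have hx := hr.2 u w (hne u (by simp))
      cases hb : Nat.beq (T % 2) 0 with
      | true =>
        have : T % 2 = 0 := Nat.eq_of_beq_eq_true hb
        refine hu.snoc_of_rel ?_
        rcases hx with hx | hx
        exacts [hx.1, absurd (h0.2 hx.1) (by omega)]
      | false =>
        have : T % 2 ≠ 0 := fun h => by simp [h] at hb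
        have := h0.1 (by omega)
        exact hu.snoc_of_not_rel (by rcases hx with hx | hx; exact absurd this hx.2; exact hx.2)
  obtain ⟨l', hl', he⟩ := aux rows vs m k hm (fun u hu h => hw (h ▸ hu)) hrow
  exact ⟨_, List.rel_append hl' (.cons (hrow.snoc_of_not_rel (hr.1 w)) .nil), he⟩

end

section

variable {V : Type*}

/-! ### Labelling a tournament by vertices of a target tournament -/

/-- A row that an additional vertex may have towards a base tournament, together with the label
it gets in the target tournament (if any) and the indices of the rows that may be beaten. -/
structure Cand where
  /-- position in the list of candidates -/
  idx : ℕ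
  /-- digits recording the beaten base vertices -/
  mask : ℕ
  /-- the label -/
  label : ℕ
  /-- digits recording the candidates that may be beaten -/
  out : ℕ

/-- Run through the possible arcs between a vertex with candidate `c` and vertices with
candidates `us`, and check `final` for the resulting rows. -/
noncomputable def orient (c : Cand) (final : ℕ → ℕ → Bool) (us : List Cand) : ℕ → ℕ → Bool :=
  List.rec (motive := fun _ => ℕ → ℕ → Bool) (fun e m => final e m)
    (fun u _ ih e m => force (Nat.add e e) fun e' =>
      sel (sel (bit u.out c.idx) (ih e' m) true)
        (sel (bit c.out u.idx) (force (Nat.lor m e) fun m' => ih e' m') true) false) us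

/-- Whether `labels` identifies the tournament `rows` with a part of `target`. -/
noncomputable def isLabelling (target rows labels : List ℕ) : Bool :=
  (List.range rows.length).all fun i => (List.range rows.length).all fun j =>
    Nat.blt (labels.getD i 0) target.length &&
      (bit (rows.getD i 0) j == bit (target.getD (labels.getD i 0) 0) (labels.getD j 0))

/-- Whether all extensions of the tournament `rows` by `n` further vertices without a transitive
chain of length `q` are identified with a part of `target` by the labels of their candidates.
The number `e` is `2` to the number of base vertices. -/
noncomputable def search (q e : ℕ) (target : List ℕ) (n : ℕ) :
    List Cand → List ℕ → List Cand → List ℕ → Bool :=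
  Nat.rec (motive := fun _ => List Cand → List ℕ → List Cand → List ℕ → Bool)
    (fun _ rows _ labels => isLabelling target rows labels)
    (fun _ ih suffix rows used labels =>
      List.rec (motive := fun _ => Bool) true
        (fun c tl ihl => sel (orient c (fun e m => extend m e rows m fun rows' =>
            sel (hasChain rows' q) true (ih (c :: tl) rows' (used ++ [c]) (labels ++ [c.label])))
            used e c.mask) ihl false) suffix) n

/-- Whether every possible row towards the base tournament is listed as a candidate. -/
noncomputable def covers (q e : ℕ) (base : List ℕ) (cands : List Cand) : Bool :=
  (List.range e).all fun m => extend m e base m fun rows =>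
    hasChain rows q || cands.any fun c => Nat.beq c.mask m

/-- Whether all possible arcs between candidates are listed. -/
noncomputable def coversPairs (q e : ℕ) (base : List ℕ) (cands : List Cand) : Bool :=
  cands.all fun a => extend a.mask e base a.mask fun rows => cands.all fun b =>
    bit a.out b.idx || extend b.mask (2 * e) rows b.mask fun rows' => hasChain rows' q

theorem isLabelling_iff {target rows labels : List ℕ} : isLabelling target rows labels = true ↔
    ∀ i < rows.length, ∀ j < rows.length, labels.getD i 0 < target.length ∧
      ((rows.getD i 0).testBit j =
        (target.getD (labels.getD i 0) 0).testBit (labels.getD j 0)) := by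
  simp only [isLabelling, List.all_eq_true, List.mem_range, Bool.and_eq_true, bit_eq, beq_iff_eq,
    Nat.blt_eq]

theorem search_succ_cons (q e : ℕ) (target : List ℕ) (n : ℕ) (c : Cand) (tl : List Cand)
    (rows : List ℕ) (used : List Cand) (labels : List ℕ) :
    search q e target (n + 1) (c :: tl) rows used labels =
      sel (orient c (fun e' m => extend m e' rows m fun rows' => sel (hasChain rows' q) true
        (search q e target n (c :: tl) rows' (used ++ [c]) (labels ++ [c.label])))
        used e c.mask) (search q e target (n + 1) tl rows used labels) false := rfl

theorem exists_isRow (r : V → V → Prop) (v : V) (vs : List V) : ∃ m, IsRow r m v vs := by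
  induction vs using List.reverseRecOn with
  | nil => exact ⟨0, fun j => by simp⟩
  | append_singleton vs w ih =>
    obtain ⟨m, hm⟩ := ih
    by_cases hw : r v w
    · exact ⟨_, hm.snoc_of_rel hw⟩
    · exact ⟨_, hm.snoc_of_not_rel hw⟩

theorem orient_sound {r : V → V → Prop} {c : Cand} {final : ℕ → ℕ → Bool} {w : V} {us : List Cand}
    {ws : List V} (h : List.Forall₂ (fun u v => (r w v → bit c.out u.idx = true) ∧
      (¬ r w v → bit u.out c.idx = true)) us ws) {vs : List V} {m : ℕ} (hm : IsRow r m w vs)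
    (ho : orient c final us (2 ^ vs.length) m = true) :
    ∃ m', IsRow r m' w (vs ++ ws) ∧ final (2 ^ (vs ++ ws).length) m' = true := by
  induction h generalizing vs m with
  | nil => exact ⟨m, by simpa using hm, by rw [List.append_nil]; exact ho⟩
  | @cons u v us ws huv _ ih =>
    have key : orient c final (u :: us) (2 ^ vs.length) m =
        sel (sel (bit u.out c.idx) (orient c final us (2 ^ (vs ++ [v]).length) m) true)
          (sel (bit c.out u.idx) (orient c final us (2 ^ (vs ++ [v]).length)
            (m ||| 2 ^ vs.length)) true) false := by
      unfold orient
      simp only [force_eq, nat_ops, List.length_append, List.length_singleton, pow_succ, mul_two]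
    rw [key] at ho
    have hs : ∀ {a b : Bool}, sel a b false = true → a = true ∧ b = true := by
      intro a b; cases a <;> simp
    obtain ⟨h1, h2⟩ := hs ho
    by_cases hw : r w v
    · rw [huv.1 hw, sel_true] at h2
      simpa using ih (hm.snoc_of_rel hw) h2
    · rw [huv.2 hw, sel_true] at h1
      simpa using ih (hm.snoc_of_not_rel hw) h1

theorem ChainFree.mono {r : V → V → Prop} {k : ℕ} {S T : Set V} (h : ChainFree r k T)
    (hST : S ⊆ T) : ChainFree r k S :=
  fun l hl hp hS => h l hl hp fun x hx => hST (hS x hx)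

/-- The possible behaviours of the vertices `v` and `w` relative to a base tournament. -/
theorem search_sound {r : V → V → Prop} (hr : IsTournament r) {q : ℕ} {vs₀ : List V}
    {target : List ℕ} {cands : List Cand} (hs : cands.Pairwise fun a b => a.idx < b.idx)
    {X : Set V} (hX : ChainFree r q X) (cf : V → Cand) {ws : List V} {suffix : List Cand}
    {vs : List V} {rows labels : List ℕ} (hsuf : suffix <:+ cands)
    (hcf : ∀ w ∈ ws, cf w ∈ suffix) (hsort : ws.Pairwise fun a b => (cf a).idx ≤ (cf b).idx)
    (hrow : ∀ w ∈ ws, IsRow r (cf w).mask w vs₀)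
    (hpair : ∀ v ∈ vs ++ ws, ∀ w ∈ vs ++ ws, r v w → bit (cf v).out (cf w).idx = true)
    (hm : IsModel r rows (vs₀ ++ vs)) (hnd : (vs₀ ++ vs ++ ws).Nodup)
    (hmem : ∀ x ∈ vs₀ ++ vs ++ ws, x ∈ X) (hlab : labels.length = (vs₀ ++ vs).length)
    (hlen : (vs₀ ++ vs ++ ws).length ≤ 32)
    (hsearch : search q (2 ^ vs₀.length) target ws.length suffix rows
      (vs.map cf) labels = true) :
    ∃ rows labels, IsModel r rows (vs₀ ++ vs ++ ws) ∧ labels.length = (vs₀ ++ vs ++ ws).length ∧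
      isLabelling target rows labels = true := by
  induction ws generalizing suffix vs rows labels with
  | nil => exact ⟨rows, labels, by simpa using hm, by simpa using hlab, hsearch⟩
  | cons w ws ih =>
    obtain ⟨pre, tl, rfl⟩ := List.append_of_mem (hcf w (by simp))
    have hsuf' : cf w :: tl <:+ cands := (List.suffix_append _ _).trans hsuf
    have hstep : ∀ l : List Cand, search q (2 ^ vs₀.length) target (ws.length + 1)
        (l ++ cf w :: tl) rows (vs.map cf) labels = true →
        orient (cf w) (fun e m => extend m e rows m fun rows' =>
            sel (hasChain rows' q) true
              (search q (2 ^ vs₀.length) target ws.length (cf w :: tl) rows' (vs.map cf ++ [cf w])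
                (labels ++ [(cf w).label]))) (vs.map cf) (2 ^ vs₀.length) (cf w).mask = true := by
      have hsel : ∀ {a b : Bool}, sel a b false = true → a = true ∧ b = true := by
        intro a b; cases a <;> simp
      intro l
      induction l with
      | nil =>
        intro h
        rw [List.nil_append, search_succ_cons] at h
        exact (hsel h).1
      | cons c l ihl => 
        intro h
        rw [List.cons_append, search_succ_cons] at h
        exact ihl (hsel h).2
    have horient := hstep _ hsearch
    have hwnd : w ∉ vs₀ ++ vs := by
      intro h
      exact (List.nodup_append.1 hnd).2.2 w h w (by simp) rfl
    obtain ⟨m, hrow', hfin⟩ := orient_sound (ws := vs) (by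
      rw [List.forall₂_map_left_iff, List.forall₂_same]
      intro v hv
      refine ⟨fun h => hpair w (by simp) v (by simp [hv]) h,
        fun h => hpair v (by simp [hv]) w (by simp) ?_⟩
      have hne : w ≠ v := fun h => hwnd (by simp [h, hv])
      rcases hr.2 w v hne with h' | h'
      exacts [absurd h'.1 h, h'.1]) (hrow w (by simp)) horient
    obtain ⟨rows', hm', he⟩ := extend_eq m hr hm hwnd hrow' _
    rw [he, hm'.hasChain_eq_false (by simp at hlen ⊢; omega) (fun x hx => hmem x (by
      simp only [List.mem_append, List.mem_cons, List.not_mem_nil, or_false] at hx ⊢; tauto)) hX,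
      sel_false] at hfin
    have := ih (suffix := cf w :: tl) (vs := vs ++ [w]) (rows := rows')
      (labels := labels ++ [(cf w).label]) hsuf' ?_ hsort.tail (fun x hx => hrow x (by simp [hx]))
      (by simpa using hpair) (by simpa using hm') (by simpa using hnd) (by simpa using hmem)
      (by simp [hlab]; omega) (by simp at hlen ⊢; omega) (by simpa [add_assoc] using hfin)
    · simpa using this
    · intro x hx
      have h1 := hcf x (by simp [hx])
      rw [List.mem_append] at h1
      refine h1.resolve_left fun h => ?_
      have h2 := (List.pairwise_append.1 (hs.sublist hsuf.sublist)).2.2 _ h (cf w) (by simp)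
      have h3 := (List.pairwise_cons.1 hsort).1 x hx
      omega

/-- If the search succeeds, a chain-free tournament containing the base tournament is
identified with a part of the target tournament. -/
theorem exists_labels {r : V → V → Prop} (hr : IsTournament r) {q : ℕ} {vs ws : List V}
    {base labels target : List ℕ} {cands : List Cand}
    (hs : cands.Pairwise fun a b => a.idx < b.idx)
    (hc : covers q (2 ^ vs.length) base cands = true)
    (hp : coversPairs q (2 ^ vs.length) base cands = true)
    (hsearch : search q (2 ^ vs.length) target ws.length cands base [] labels
      = true)
    (hm : IsModel r base vs) (hnd : (vs ++ ws).Nodup)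
    (hlen : (vs ++ ws).length < 32) (hlab : labels.length = vs.length)
    {X : Set V} (hX : ChainFree r q X) (hmem : ∀ x ∈ vs ++ ws, x ∈ X) {n k : ℕ}
    (hn : vs.length + ws.length = n) (hk : target.length = k) :
    ∃ (f : Fin n → V) (ψ : Fin n → Fin k), (∀ i, f i ∈ X) ∧ Function.Injective f ∧
      ∀ i j, r (f i) (f j) ↔ (target.getD (ψ i) 0).testBit (ψ j) = true := by
  classical
  subst hn hk
  have hcov : ∀ w ∈ ws, ∃ c ∈ cands, IsRow r c.mask w vs := by
    intro w hw
    obtain ⟨m, hrow⟩ := exists_isRow r w vs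
    have hw' : w ∉ vs := fun h => (List.nodup_append.1 hnd).2.2 w h w hw rfl
    have h1 := List.all_eq_true.1 hc m (List.mem_range.2 hrow.lt)
    obtain ⟨rows', hm', he⟩ := extend_eq m hr hm hw' hrow _
    rw [he, hm'.hasChain_eq_false (by
      have := List.length_pos_of_mem hw
      simp at hlen ⊢; omega) (fun x hx => hmem x (by
      simp only [List.mem_append, List.mem_cons, List.not_mem_nil, or_false] at hx ⊢
      rcases hx with hx | rfl <;> tauto)) hX, Bool.false_or, List.any_eq_true] at h1
    obtain ⟨c, hc, hcm⟩ := h1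
    exact ⟨c, hc, by rwa [Nat.eq_of_beq_eq_true hcm]⟩
  have : Nonempty Cand := ⟨⟨0, 0, 0, 0⟩⟩
  choose! cf hcf hrow using hcov
  have hpair : ∀ v ∈ ws, ∀ w ∈ ws, r v w → bit (cf v).out (cf w).idx = true := by
    intro v hv w hw hvw
    have hv' : v ∉ vs := fun h => (List.nodup_append.1 hnd).2.2 v h v hv rfl
    have hw' : w ∉ vs ++ [v] := by
      intro h
      rcases List.mem_append.1 h with h | h
      · exact (List.nodup_append.1 hnd).2.2 w h w hw rfl
      · rw [List.mem_singleton.1 h] at hvw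
        exact hr.1 v hvw
    have hwv : ¬ r w v := by
      have hne : v ≠ w := fun h => hr.1 v (by rwa [← h] at hvw)
      rcases hr.2 v w hne with h | h
      exacts [h.2, absurd hvw h.2]
    have h1 := List.all_eq_true.1 hp _ (hcf v hv)
    obtain ⟨rows', hm', he⟩ := extend_eq _ hr hm hv' (hrow v hv) _
    rw [he] at h1
    have h2 := List.all_eq_true.1 h1 _ (hcf w hw)
    rw [Bool.or_eq_true] at h2
    refine h2.resolve_right fun h2 => ?_
    have hpow : 2 * 2 ^ vs.length = 2 ^ (vs ++ [v]).length := by simp [pow_succ, mul_comm]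
    rw [hpow] at h2
    obtain ⟨rows'', hm'', he'⟩ := extend_eq _ hr hm' hw' ((hrow w hw).snoc_of_not_rel hwv)
      fun rows' => hasChain rows' q
    rw [he', hm''.hasChain_eq_false (by
      have := List.length_pos_of_mem hw
      simp at hlen ⊢; omega) (fun x hx => hmem x (by
      simp only [List.mem_append, List.mem_cons, List.not_mem_nil, or_false] at hx ⊢
      rcases hx with (hx | rfl) | rfl <;> tauto)) hX] at h2
    exact absurd h2 (by simp)
  let le : V → V → Bool := fun a b => decide ((cf a).idx ≤ (cf b).idx)
  let ws' := ws.mergeSort le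
  have hperm : ws'.Perm ws := List.mergeSort_perm ws le
  have hsort : ws'.Pairwise fun a b => (cf a).idx ≤ (cf b).idx := by
    have := List.pairwise_mergeSort (le := le) (by simp only [le, decide_eq_true_iff]; omega)
      (by simp only [le, Bool.or_eq_true, decide_eq_true_iff]; omega) ws
    simpa only [le, decide_eq_true_iff] using this
  have hmw : ∀ {x}, x ∈ ws' ↔ x ∈ ws := hperm.mem_iff
  have hlen' : ws'.length = ws.length := hperm.length_eq
  obtain ⟨rows, labs, hm', hl, hmat⟩ := search_sound hr hs hX cf (vs₀ := vs) (vs := []) (ws := ws')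
    (suffix := cands) (rows := base) (labels := labels) (target := target) (List.suffix_refl _)
    (fun w hw => hcf w (hmw.1 hw)) hsort (fun w hw => hrow w (hmw.1 hw))
    (fun v hv w hw => hpair v (hmw.1 hv) w (hmw.1 hw)) (by simpa using hm)
    (by simpa using (hperm.append_left vs).nodup_iff.2 hnd)
    (by
      intro x hx
      refine hmem x ?_
      simpa [hmw] using hx) (by simpa using hlab)
    (by
      rw [List.length_append] at hlen
      simp only [List.append_nil, List.length_append, hlen']; omega)
    (by simpa [hlen'] using hsearch)
  have hrl := hm'.length_eq
  have hvl : (vs ++ [] ++ ws').length = vs.length + ws.length := by simp [hlen']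
  rw [isLabelling_iff] at hmat
  rw [List.append_nil] at hm' hrl hvl
  refine ⟨fun i => (vs ++ ws')[i], fun i => ⟨labs.getD i 0,
    (hmat i (by omega) i (by omega)).1⟩, fun i => ?_, fun i j hij => ?_, fun i j => ?_⟩
  · refine hmem _ ?_
    rw [List.mem_append, ← hmw, ← List.mem_append]
    exact List.getElem_mem _
  · exact Fin.ext ((((hperm.append_left vs).nodup_iff.2 hnd).getElem_inj_iff).1 hij)
  · rw [← (hmat i (by omega) j (by omega)).2, List.getD_eq_getElem _ _ (by omega)]
    have h := hm'.get (i := i) (by omega) (by omega) j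
    simp only [List.get_eq_getElem] at h
    rw [h]
    have hj : (vs ++ ws')[(j : ℕ)]? = some (vs ++ ws')[j] :=
      List.getElem?_eq_getElem (by omega)
    simp [hj]

end

section

variable {V : Type*}

/-! ### Tournaments without short chains on 6 and 12 vertices -/

/-- The rows of the Paley tournament on 7 vertices. -/
def paley7 : List ℕ := [22, 44, 88, 49, 98, 69, 11]

/-- The rows of the circulant tournament on 13 vertices with connection set
`{1, 2, 3, 5, 6, 9}`. -/
def circ13 : List ℕ :=
  [622, 1244, 2488, 4976, 1761, 3522, 7044, 5897, 3603, 7206, 6221, 4251, 311]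

/-- Candidates relative to the vertices 0, 1, 2, 4 of `paley7`. -/
def cands7 : List Cand :=
  [⟨0, 1, 7, 0⟩, ⟨1, 3, 6, 8⟩, ⟨2, 5, 5, 2⟩, ⟨3, 9, 3, 4⟩]

/-- Candidates relative to the vertices 0, 1, 3, 6, 9, 2, 5 of `circ13`. -/
def cands13 : List Cand :=
  [⟨0, 1, 13, 1073744896⟩, ⟨1, 3, 13, 1309675008⟩, ⟨2, 5, 13, 1879092480⟩,
   ⟨3, 7, 11, 2115515264⟩, ⟨4, 9, 13, 557845504⟩, ⟨5, 11, 13, 2145389568⟩,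
   ⟨6, 13, 13, 557886720⟩, ⟨7, 17, 13, 1090915400⟩, ⟨8, 19, 8, 1268187724⟩,
   ⟨9, 21, 7, 1900454186⟩, ⟨10, 22, 13, 2147482623⟩, ⟨11, 23, 13, 2129645815⟩,
   ⟨12, 25, 13, 25167880⟩, ⟨13, 27, 13, 1132462088⟩, ⟨14, 33, 13, 134233088⟩,
   ⟨15, 35, 13, 202391040⟩, ⟨16, 37, 13, 10528⟩, ⟨17, 41, 13, 557844488⟩,
   ⟨18, 45, 10, 557885738⟩, ⟨19, 49, 13, 1241922672⟩, ⟨20, 53, 13, 1073881376⟩,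
   ⟨21, 65, 13, 1379328⟩, ⟨22, 67, 13, 1575424⟩, ⟨23, 69, 13, 1881132032⟩,
   ⟨24, 71, 13, 1343750656⟩, ⟨25, 73, 13, 1378816⟩, ⟨26, 81, 13, 18156616⟩,
   ⟨27, 89, 4, 26544716⟩, ⟨28, 97, 13, 134232320⟩, ⟨29, 99, 12, 202914688⟩, ⟨30, 105, 13, 2048⟩]

theorem cands7_sorted : cands7.Pairwise fun a b => a.idx < b.idx := by decide +kernel

theorem cands7_covers : covers 4 16 [14, 4, 8, 2] cands7 = true := by decide +kernel

theorem cands7_coversPairs : coversPairs 4 16 [14, 4, 8, 2] cands7 = true := by decide +kernel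

theorem search_paley7 :
    search 4 16 paley7 2 cands7 [14, 4, 8, 2] [] [0, 1, 2, 4] = true := by decide +kernel

theorem cands13_sorted : cands13.Pairwise fun a b => a.idx < b.idx := by decide +kernel

theorem cands13_covers :
    covers 5 128 [126, 44, 88, 48, 98, 68, 10] cands13 = true := by decide +kernel

theorem cands13_coversPairs :
    coversPairs 5 128 [126, 44, 88, 48, 98, 68, 10] cands13 = true := by decide +kernel

set_option maxRecDepth 100000 in
theorem search_circ13 :
    search 5 128 circ13 5 cands13 [126, 44, 88, 48, 98, 68, 10] [] [0, 1, 3, 6, 9, 2, 5] =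
      true := by
  decide +kernel

end

section

variable {V : Type*}

/-! ### Degrees and chain-free sets -/

theorem _root_.IsTournament.not_rel_iff {r : V → V → Prop} (hr : IsTournament r) {v w : V}
    (h : v ≠ w) : ¬ r v w ↔ r w v := by
  rcases hr.2 v w h with h | h <;> simp [h.1, h.2]

theorem _root_.IsTournament.ne_of_rel {r : V → V → Prop} (hr : IsTournament r) {v w : V}
    (h : r v w) : v ≠ w := by
  rintro rfl
  exact hr.1 _ h

theorem _root_.IsTournament.asymm {r : V → V → Prop} (hr : IsTournament r) {v w : V} (h : r v w) :
    ¬ r w v :=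
  (hr.not_rel_iff (hr.ne_of_rel h).symm).2 h

theorem ChainFree.out {r : V → V → Prop} {k : ℕ} {X : Set V} (h : ChainFree r (k + 1) X) {v : V}
    (hv : v ∈ X) : ChainFree r k {w | w ∈ X ∧ r v w} := by
  intro l hl hp hX
  refine h (v :: l) (by simp [hl]) (List.pairwise_cons.2 ⟨fun w hw => (hX w hw).2, hp⟩) ?_
  intro w hw
  rcases List.mem_cons.1 hw with rfl | hw
  exacts [hv, (hX w hw).1]

theorem ChainFree.inn {r : V → V → Prop} {k : ℕ} {X : Set V} (h : ChainFree r (k + 1) X) {v : V}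
    (hv : v ∈ X) : ChainFree r k {w | w ∈ X ∧ r w v} := by
  intro l hl hp hX
  refine h (l ++ [v]) (by simp [hl]) (List.pairwise_append.2 ⟨hp, by simp, fun w hw x hx => ?_⟩) ?_
  · rw [List.mem_singleton.1 hx]
    exact (hX w hw).2
  · intro w hw
    rcases List.mem_append.1 hw with hw | hw
    exacts [(hX w hw).1, by rwa [List.mem_singleton.1 hw]]

open Classical in
theorem card_out_add_card_in {r : V → V → Prop} (hr : IsTournament r) {X : Finset V} {v : V}
    (hv : v ∈ X) : (X.filter fun w => r v w).card + (X.filter fun w => r w v).card + 1 =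
      X.card := by
  have h1 : (X.erase v).filter (fun w => r v w) = X.filter fun w => r v w := by
    ext w
    simp only [Finset.mem_filter, Finset.mem_erase]
    exact ⟨fun h => ⟨h.1.2, h.2⟩, fun h => ⟨⟨(hr.ne_of_rel h.2).symm, h.1⟩, h.2⟩⟩
  have h2 : (X.erase v).filter (fun w => ¬ r v w) = X.filter fun w => r w v := by
    ext w
    simp only [Finset.mem_filter, Finset.mem_erase]
    exact ⟨fun h => ⟨h.1.2, (hr.not_rel_iff h.1.1.symm).1 h.2⟩,
      fun h => ⟨⟨hr.ne_of_rel h.2, h.1⟩, hr.asymm h.2⟩⟩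
  rw [← h1, ← h2, Finset.card_filter_add_card_filter_not, Finset.card_erase_add_one hv]

open Classical in
theorem sum_card_out {r : V → V → Prop} (hr : IsTournament r) (X : Finset V) :
    2 * ∑ v ∈ X, (X.filter fun w => r v w).card + X.card = X.card * X.card := by
  have h1 : ∑ v ∈ X, (X.filter fun w => r v w).card = ∑ v ∈ X, (X.filter fun w => r w v).card :=
    Finset.sum_card_bipartiteAbove_eq_sum_card_bipartiteBelow r
  have h2 : ∑ v ∈ X, ((X.filter fun w => r v w).card + (X.filter fun w => r w v).card + 1) =
      X.card * X.card := by
    rw [Finset.sum_congr rfl fun v hv => card_out_add_card_in hr hv, Finset.sum_const, smul_eq_mul]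
  rw [Finset.sum_add_distrib, Finset.sum_add_distrib, ← h1, Finset.sum_const, smul_eq_mul,
    mul_one] at h2
  omega

open Classical in
theorem exists_card_le_out {r : V → V → Prop} (hr : IsTournament r) {X : Finset V}
    (hX : X.Nonempty) : ∃ v ∈ X, X.card ≤ 2 * (X.filter fun w => r v w).card + 1 := by
  by_contra! h
  have h1 : ∑ v ∈ X, (2 * (X.filter fun w => r v w).card + 1) < ∑ _v ∈ X, X.card :=
    Finset.sum_lt_sum_of_nonempty hX h
  rw [Finset.sum_add_distrib, ← Finset.mul_sum, Finset.sum_const, Finset.sum_const, smul_eq_mul,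
    smul_eq_mul, mul_one, sum_card_out hr X] at h1
  exact lt_irrefl _ h1

/-- The map `φ` takes the numbers `i` to vertices with the arcs recorded in `rows`. -/
def Realizes (r : V → V → Prop) {n : ℕ} (φ : Fin n → V) (rows : List ℕ) : Prop :=
  ∀ i j : Fin n, r (φ i) (φ j) ↔ (rows.getD i 0).testBit j = true

theorem isModel_ofFn {r : V → V → Prop} {n : ℕ} {φ : Fin n → V} {rows : List ℕ}
    (h : Realizes r φ rows) (hlen : rows.length = n) (hrows : ∀ row ∈ rows, row < 2 ^ n) :
    IsModel r rows (List.ofFn φ) := by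
  refine List.forall₂_iff_get.2 ⟨by simp [hlen], fun i hi _ j => ?_⟩
  simp only [List.get_eq_getElem, List.getElem_ofFn]
  have hi' : i < n := hlen ▸ hi
  have key := fun hj => h ⟨i, hi'⟩ ⟨j, hj⟩
  simp only [List.getD_eq_getElem _ _ hi] at key
  constructor
  · intro hb
    have hj : j < n := (Nat.pow_lt_pow_iff_right one_lt_two).1
      ((Nat.ge_two_pow_of_testBit hb).trans_lt (hrows _ (List.getElem_mem hi)))
    exact ⟨φ ⟨j, hj⟩, by simp [hj], (key hj).2 hb⟩
  · rintro ⟨w, hw, hr⟩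
    by_cases hj : j < n
    · simp only [List.getElem?_ofFn, hj, dite_true, Option.some_inj] at hw
      subst hw
      exact (key hj).1 hr
    · simp [hj] at hw

theorem exists_realizes {r : V → V → Prop} (hr : IsTournament r) {n : ℕ} {rows : List ℕ}
    (hdiag : ∀ x : Fin (n + 1), (rows.getD x 0).testBit x = false)
    (hrot : ∀ s x y : Fin (n + 1),
      (rows.getD (x + s : Fin (n + 1)) 0).testBit (y + s : Fin (n + 1)) =
        (rows.getD x 0).testBit y)
    {X : Set V} {f : Fin n → V} {ψ : Fin n → Fin (n + 1)} (hX : ∀ i, f i ∈ X)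
    (hf : Function.Injective f)
    (h : ∀ i j, r (f i) (f j) ↔ (rows.getD (ψ i) 0).testBit (ψ j) = true) :
    ∃ φ : Fin n → V, (∀ i, φ i ∈ X) ∧ Function.Injective φ ∧ Realizes r φ rows := by
  have hψ : Function.Injective ψ := by
    intro i j hij
    by_contra hne
    have h1 := h i j
    have h2 := h j i
    rw [hij, hdiag] at h1 h2
    rcases hr.2 _ _ (hf.ne hne) with h3 | h3
    exacts [absurd (h1.1 h3.1) (by simp), absurd (h2.1 h3.1) (by simp)]
  obtain ⟨y, hy⟩ : ∃ y, ∀ i, ψ i ≠ y := by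
    by_contra! hs
    have := Fintype.card_le_of_surjective ψ hs
    simp at this
  have himage : Finset.univ.image ψ = Finset.univ.erase y := by
    refine Finset.eq_of_subset_of_card_le (fun x hx => ?_) ?_
    · obtain ⟨i, -, rfl⟩ := Finset.mem_image.1 hx
      simp [hy i]
    · rw [Finset.card_image_of_injective _ hψ, Finset.card_erase_of_mem (by simp)]
      simp
  have hex : ∀ x : Fin n, ∃ i, ψ i = x.castSucc + (y + 1) := by
    intro x
    have : x.castSucc + (y + 1) ∈ Finset.univ.image ψ := by
      rw [himage]
      simp only [Finset.mem_erase, Finset.mem_univ, and_true]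
      intro hx
      have h1 : x.castSucc + 1 = 0 := by
        have : x.castSucc + 1 + y = 0 + y := by rw [zero_add, add_assoc, add_comm 1 y, hx]
        exact add_right_cancel this
      rw [Fin.coeSucc_eq_succ] at h1
      exact Fin.succ_ne_zero _ h1
    obtain ⟨i, -, hi⟩ := Finset.mem_image.1 this
    exact ⟨i, hi⟩
  choose g hg using hex
  refine ⟨fun x => f (g x), fun x => hX _, fun x z hxz => ?_, fun x z => ?_⟩
  · have h1 : g x = g z := hf hxz
    have h2 := hg x
    rw [h1, hg z] at h2
    exact (Fin.castSucc_injective _ (add_right_cancel h2)).symm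
  · rw [h, hg, hg, hrot]
    simp

theorem exists_realizes_of_search {r : V → V → Prop} (hr : IsTournament r) {q n k : ℕ}
    {base labels target : List ℕ} {cands : List Cand}
    (hs : cands.Pairwise fun a b => a.idx < b.idx)
    (hc : covers q (2 ^ k) base cands = true) (hp : coversPairs q (2 ^ k) base cands = true)
    (hsearch : search q (2 ^ k) target (n - k) cands base [] labels = true)
    (hdiag : ∀ x : Fin (n + 1), (target.getD x 0).testBit x = false)
    (hrot : ∀ s x y : Fin (n + 1),
      (target.getD (x + s : Fin (n + 1)) 0).testBit (y + s : Fin (n + 1)) =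
        (target.getD x 0).testBit y)
    (hn : n < 32) (hlab : labels.length = k) (htar : target.length = n + 1)
    {X : Finset V} (hX : X.card = n) (hfree : ChainFree r q X) {φ : Fin k → V}
    (hφ : ∀ i, φ i ∈ X) (hinj : Function.Injective φ) (hrel : Realizes r φ base)
    (hlen : base.length = k) (hrows : ∀ row ∈ base, row < 2 ^ k) :
    ∃ φ : Fin n → V, (∀ i, φ i ∈ X) ∧ Function.Injective φ ∧ Realizes r φ target := by
  classical
  have hsub : Finset.univ.image φ ⊆ X := fun x hx => by
    obtain ⟨i, -, rfl⟩ := Finset.mem_image.1 hx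
    exact hφ i
  have hcard : (Finset.univ.image φ).card = k := by
    rw [Finset.card_image_of_injective _ hinj]; simp
  have hws : (X \ Finset.univ.image φ).toList.length = n - k := by
    rw [Finset.length_toList, Finset.card_sdiff_of_subset hsub, hX, hcard]
  have hkn : k ≤ n := hX ▸ hcard ▸ Finset.card_le_card hsub
  have hvs : (List.ofFn φ).length = k := by simp
  have hpow : 2 ^ k = 2 ^ (List.ofFn φ).length := by rw [hvs]
  rw [hpow] at hc hp hsearch
  rw [← hws] at hsearch
  obtain ⟨f, ψ, hfX, hf, h⟩ := exists_labels (n := n) (k := n + 1) hr hs hc hp hsearch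
    (isModel_ofFn hrel hlen hrows) (by
      refine List.nodup_append.2 ⟨List.nodup_ofFn.2 hinj, Finset.nodup_toList _, ?_⟩
      rintro x hx y hy rfl
      obtain ⟨i, rfl⟩ := (List.mem_ofFn' _ _).1 hx
      simp at hy)
    (by rw [List.length_append, hws, hvs]; omega) (by rw [hlab, hvs]) hfree (by
      intro x hx
      rcases List.mem_append.1 hx with hx | hx
      · obtain ⟨i, rfl⟩ := (List.mem_ofFn' _ _).1 hx
        exact hφ i
      · exact (Finset.mem_sdiff.1 (Finset.mem_toList.1 hx)).1)
    (by rw [hws, hvs]; omega) htar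
  exact exists_realizes hr hdiag hrot hfX hf h

theorem exists_realizes_paley7 {r : V → V → Prop} (hr : IsTournament r) {X : Finset V}
    (hX : 6 ≤ X.card) (h : ChainFree r 4 X) :
    ∃ φ : Fin 6 → V, (∀ i, φ i ∈ X) ∧ Function.Injective φ ∧ Realizes r φ paley7 := by
  classical
  obtain ⟨Y, hYX, hY⟩ := Finset.exists_subset_card_eq hX
  obtain ⟨v, hv, hd⟩ := exists_card_le_out hr (Finset.card_pos.1 (by omega : 0 < Y.card))
  obtain ⟨Z, hZ, hZ3⟩ := Finset.exists_subset_card_eq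
    (show 3 ≤ (Y.filter fun w => r v w).card by omega)
  have hfree : ChainFree r 3 (Z : Set V) := (h.out (hYX hv)).mono fun w hw => by
    have := Finset.mem_filter.1 (hZ hw)
    exact ⟨hYX this.1, this.2⟩
  have hcyc : ∀ a ∈ Z, ∀ b ∈ Z, ∀ c ∈ Z, c ≠ a → c ≠ b → r a b → r b c ∧ r c a := by
    intro a ha b hb c hc hca hcb hab
    have key : ∀ x ∈ Z, ∀ y ∈ Z, ∀ z ∈ Z, r x y → r y z → ¬ r x z := by
      intro x hx y hy z hz hxy hyz hxz
      exact hfree [x, y, z] rfl (by simp [hxy, hyz, hxz]) (by simp [hx, hy, hz])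
    have hbc : r b c := by
      by_contra hbc
      rw [hr.not_rel_iff hcb.symm] at hbc
      by_cases hac : r a c
      · exact key a ha c hc b hb hac hbc hab
      · exact key c hc a ha b hb ((hr.not_rel_iff hca.symm).1 hac) hab hbc
    exact ⟨hbc, (hr.not_rel_iff hca.symm).1 (key a ha b hb c hc hab hbc)⟩
  obtain ⟨a, ha, b, hb, c, hc, hab, hbc, hca⟩ : ∃ a ∈ Z, ∃ b ∈ Z, ∃ c ∈ Z,
      r a b ∧ r b c ∧ r c a := by
    obtain ⟨a, b, c, hab, hac, hbc, rfl⟩ := Finset.card_eq_three.1 hZ3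
    rcases hr.2 a b hab with h | h
    · exact ⟨a, by simp, b, by simp, c, by simp, h.1,
        hcyc a (by simp) b (by simp) c (by simp) hac.symm hbc.symm h.1⟩
    · exact ⟨b, by simp, a, by simp, c, by simp, h.1,
        hcyc b (by simp) a (by simp) c (by simp) hbc.symm hac.symm h.1⟩
  have hva := (Finset.mem_filter.1 (hZ ha)).2
  have hvb := (Finset.mem_filter.1 (hZ hb)).2
  have hvc := (Finset.mem_filter.1 (hZ hc)).2
  have hm : ∀ {x}, x ∈ Z → x ∈ Y := fun hx => (Finset.mem_filter.1 (hZ hx)).1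
  have hrel : Realizes r ![v, a, b, c] [14, 4, 8, 2] := by
    have h0 := hr.1
    intro i j
    fin_cases i <;> fin_cases j <;>
      simp [hva, hvb, hvc, hab, hbc, hca, hr.1, hr.asymm hva, hr.asymm hvb, hr.asymm hvc,
        hr.asymm hab, hr.asymm hbc, hr.asymm hca] <;> decide
  have hinj : Function.Injective ![v, a, b, c] := by
    have h1 := hr.ne_of_rel hva
    have h2 := hr.ne_of_rel hvb
    have h3 := hr.ne_of_rel hvc
    have h4 := hr.ne_of_rel hab
    have h5 := hr.ne_of_rel hbc
    have h6 := hr.ne_of_rel hca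
    intro i j hij
    fin_cases i <;> fin_cases j <;> simp_all
  obtain ⟨φ, h1, h2, h3⟩ := exists_realizes_of_search (n := 6) (k := 4) hr cands7_sorted
    cands7_covers cands7_coversPairs search_paley7 (by decide) (by decide) (by norm_num) rfl rfl hY
    (h.mono (Finset.coe_subset.2 hYX)) (φ := ![v, a, b, c])
    (by intro i; fin_cases i <;> simp [hv, hm ha, hm hb, hm hc]) hinj hrel rfl (by decide)
  exact ⟨φ, fun i => hYX (h1 i), h2, h3⟩

theorem exists_realizes_circ13 {r : V → V → Prop} (hr : IsTournament r) {X : Finset V}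
    (hX : 12 ≤ X.card) (h : ChainFree r 5 X) :
    ∃ φ : Fin 12 → V, (∀ i, φ i ∈ X) ∧ Function.Injective φ ∧ Realizes r φ circ13 := by
  classical
  obtain ⟨Y, hYX, hY⟩ := Finset.exists_subset_card_eq hX
  obtain ⟨v, hv, hd⟩ := exists_card_le_out hr (Finset.card_pos.1 (by omega : 0 < Y.card))
  obtain ⟨f, hf, hinj, hrel⟩ := exists_realizes_paley7 hr
    (show 6 ≤ (Y.filter fun w => r v w).card by omega) ((h.out (hYX hv)).mono fun w hw => by
      have := Finset.mem_filter.1 (Finset.mem_coe.1 hw)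
      exact ⟨hYX this.1, this.2⟩)
  have hfY : ∀ i, f i ∈ Y ∧ r v (f i) := fun i => Finset.mem_filter.1 (hf i)
  obtain ⟨φ, h1, h2, h3⟩ := exists_realizes_of_search (n := 12) (k := 7) hr cands13_sorted
    cands13_covers cands13_coversPairs search_circ13 (by decide) (by decide +kernel) (by norm_num)
    rfl rfl hY (h.mono (Finset.coe_subset.2 hYX)) (φ := Fin.cons v f)
    (fun i => by
      refine Fin.cases hv (fun i => ?_) i
      exact (hfY i).1)
    (Fin.cons_injective_iff.2 ⟨by rintro ⟨i, hi⟩; exact hr.ne_of_rel (hfY i).2 hi.symm, hinj⟩)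
    (fun i j => by
      refine Fin.cases (Fin.cases ?_ (fun j => ?_) j) (fun i => Fin.cases ?_ (fun j => ?_) j) i
      · exact iff_of_false (hr.1 v) (by decide)
      · exact iff_of_true (hfY j).2 (by revert j; decide)
      · exact iff_of_false (hr.asymm (hfY i).2) (by revert i; decide)
      · simp only [Fin.cons_succ, hrel i j]
        revert i j; decide) rfl (by decide)
  exact ⟨φ, fun i => hYX (h1 i), h2, h3⟩

theorem card_le_of_chainFree {r : V → V → Prop} (hr : IsTournament r) {X : Finset V}
    (h : ChainFree r 5 X) : X.card ≤ 13 := by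
  classical
  by_contra! hX
  obtain ⟨v, hv, hd⟩ := exists_card_le_out hr (Finset.card_pos.1 (by omega : 0 < X.card))
  obtain ⟨W, hWX, hW⟩ := Finset.exists_subset_card_eq
    (show 7 ≤ (X.filter fun w => r v w).card by omega)
  have hvW : v ∉ W := fun h => hr.1 v (Finset.mem_filter.1 (hWX h)).2
  obtain ⟨Y, hWY, hYX, hY⟩ := Finset.exists_subsuperset_card_eq (s := insert v W) (t := X) (n := 12)
    (Finset.insert_subset hv (hWX.trans (Finset.filter_subset _ _)))
    (by rw [Finset.card_insert_of_notMem hvW]; omega) (by omega)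
  obtain ⟨φ, hφ, hinj, hrel⟩ := exists_realizes_circ13 hr hY.ge (h.mono (Finset.coe_subset.2 hYX))
  have himage : Finset.univ.image φ = Y := by
    refine Finset.eq_of_subset_of_card_le (fun x hx => ?_) ?_
    · obtain ⟨i, -, rfl⟩ := Finset.mem_image.1 hx
      exact hφ i
    · rw [Finset.card_image_of_injective _ hinj]
      simp [hY]
  have hex : ∀ {x}, x ∈ insert v W → ∃ i, φ i = x := by
    intro x hx
    have := hWY hx
    rw [← himage] at this
    simpa using this
  obtain ⟨i, rfl⟩ := hex (Finset.mem_insert_self _ _)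
  have hsub : W ⊆ (Finset.univ.filter fun j : Fin 12 =>
      (circ13.getD i 0).testBit j = true).image φ := by
    intro w hw
    obtain ⟨j, rfl⟩ := hex (Finset.mem_insert_of_mem hw)
    refine Finset.mem_image_of_mem _ (Finset.mem_filter.2 ⟨Finset.mem_univ _, ?_⟩)
    exact (hrel i j).1 (Finset.mem_filter.1 (hWX hw)).2
  have h1 := (Finset.card_le_card hsub).trans Finset.card_image_le
  have h2 : ∀ i : Fin 12, (Finset.univ.filter fun j : Fin 12 =>
      (circ13.getD i 0).testBit j = true).card ≤ 6 := by decide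
  have := h2 i
  omega

end

/-! ### Numerals made of fields of digits -/

/-- The `i`-th block of `w` binary digits of `C`. -/
noncomputable def field (w C i : ℕ) : ℕ :=
  Nat.mod (Nat.shiftRight C (Nat.mul w i)) (Nat.pow 2 w)

theorem testBit_field (w C i j : ℕ) :
    (field w C i).testBit j = (decide (j < w) && C.testBit (w * i + j)) := by
  simp only [field, nat_ops, Nat.testBit_mod_two_pow, Nat.testBit_shiftRight]

theorem field_lt (w C i : ℕ) : field w C i < 2 ^ w := Nat.mod_lt _ (Nat.two_pow_pos w)

theorem field_mod (w C : ℕ) {i p : ℕ} (h : i < p) :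
    field w (C % 2 ^ (w * p)) i = field w C i := by
  refine Nat.eq_of_testBit_eq fun j => ?_
  rw [testBit_field, testBit_field, Nat.testBit_mod_two_pow]
  by_cases hj : j < w
  · have : w * i + j < w * p :=
      calc w * i + j < w * i + w := by omega
        _ = w * (i + 1) := by ring
        _ ≤ w * p := Nat.mul_le_mul_left _ h
    simp [this]
  · simp [hj]

theorem field_shiftRight (w C p i : ℕ) : field w (C >>> (w * p)) i = field w C (p + i) := by
  simp only [field, nat_ops, ← Nat.shiftRight_add, mul_add]

/-- The numeral with fields `f 0, …, f (n - 1)` of `w` digits. -/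
noncomputable def concat (w : ℕ) (f : ℕ → ℕ) (n : ℕ) : ℕ :=
  Nat.rec (motive := fun _ => ℕ) 0
    (fun i ih => Nat.add ih (Nat.shiftLeft (f i) (Nat.mul w i))) n

theorem concat_succ (w : ℕ) (f : ℕ → ℕ) (n : ℕ) :
    concat w f (n + 1) = concat w f n + 2 ^ (w * n) * f n := by
  have : concat w f (n + 1) = concat w f n + f n <<< (w * n) := rfl
  rw [this, Nat.shiftLeft_eq, mul_comm (f n)]

theorem concat_add (w : ℕ) (f g : ℕ → ℕ) (n : ℕ) :
    concat w f n + concat w g n = concat w (fun i => f i + g i) n := by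
  induction n with
  | zero => rfl
  | succ n ih => rw [concat_succ, concat_succ, concat_succ, ← ih]; ring

theorem mul_concat (w c : ℕ) (f : ℕ → ℕ) (n : ℕ) :
    c * concat w f n = concat w (fun i => c * f i) n := by
  induction n with
  | zero => rfl
  | succ n ih => rw [concat_succ, concat_succ, ← ih]; ring

theorem concat_congr {w : ℕ} {f g : ℕ → ℕ} {n : ℕ} (h : ∀ i < n, f i = g i) :
    concat w f n = concat w g n := by
  induction n with
  | zero => rfl
  | succ n ih => rw [concat_succ, concat_succ, ih fun i hi => h i (by omega), h n (by omega)]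

theorem concat_lt {w : ℕ} {f : ℕ → ℕ} {n : ℕ} (h : ∀ i < n, f i < 2 ^ w) :
    concat w f n < 2 ^ (w * n) := by
  induction n with
  | zero => simp [concat]
  | succ n ih =>
    rw [concat_succ, mul_add, mul_one, pow_add]
    have h1 := ih fun i hi => h i (by omega)
    have h2 := h n (by omega)
    calc concat w f n + 2 ^ (w * n) * f n < 2 ^ (w * n) + 2 ^ (w * n) * f n := by omega
      _ = 2 ^ (w * n) * (f n + 1) := by ring
      _ ≤ 2 ^ (w * n) * 2 ^ w := Nat.mul_le_mul_left _ h2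

theorem testBit_concat {w : ℕ} {f : ℕ → ℕ} {n : ℕ} (h : ∀ i < n, f i < 2 ^ w) (i : ℕ) {j : ℕ}
    (hj : j < w) : (concat w f n).testBit (w * i + j) = (decide (i < n) && (f i).testBit j) := by
  induction n with
  | zero => simp [concat]
  | succ n ih =>
    rw [concat_succ, add_comm, Nat.testBit_two_pow_mul_add _ (concat_lt fun i hi => h i (by omega)),
      ih fun i hi => h i (by omega)]
    rcases lt_trichotomy i n with hi | rfl | hi
    · have : w * i + j < w * n :=
        calc w * i + j < w * i + w := by omega
          _ = w * (i + 1) := by ring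
          _ ≤ w * n := Nat.mul_le_mul_left _ hi
      simp [this, hi, hi.trans (Nat.lt_succ_self n)]
    · simp
    · have : w * n + w ≤ w * i :=
        calc w * n + w = w * (n + 1) := by ring
          _ ≤ w * i := Nat.mul_le_mul_left _ hi
      have hlt : f n < 2 ^ (w * i + j - w * n) :=
        (h n (by omega)).trans_le (Nat.pow_le_pow_right two_pos (by omega))
      simp [show ¬ w * i + j < w * n by omega, Nat.testBit_lt_two_pow hlt,
        show ¬ i < n + 1 by omega]

theorem field_concat {w : ℕ} {f : ℕ → ℕ} {n : ℕ} (h : ∀ i < n, f i < 2 ^ w) {i : ℕ}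
    (hi : i < n) : field w (concat w f n) i = f i := by
  refine Nat.eq_of_testBit_eq fun j => ?_
  rw [testBit_field]
  by_cases hj : j < w
  · rw [testBit_concat h i hj]
    simp [hi, hj]
  · rw [Nat.testBit_lt_two_pow ((h i hi).trans_le (Nat.pow_le_pow_right two_pos (not_lt.1 hj)))]
    simp [hj]

theorem concat_and {w : ℕ} (hw : 0 < w) {f g : ℕ → ℕ} {n : ℕ} (hf : ∀ i < n, f i < 2 ^ w)
    (hg : ∀ i < n, g i < 2 ^ w) :
    concat w f n &&& concat w g n = concat w (fun i => f i &&& g i) n := by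
  refine Nat.eq_of_testBit_eq fun p => ?_
  rw [← Nat.div_add_mod p w, Nat.testBit_and, testBit_concat hf _ (Nat.mod_lt _ hw),
    testBit_concat hg _ (Nat.mod_lt _ hw), testBit_concat (fun i hi => Nat.and_le_left.trans_lt
      (hf i hi)) _ (Nat.mod_lt _ hw), Nat.testBit_and]
  cases decide (p / w < n) <;> simp

/-- The numeral with fields `f N` of `w` digits, where `N` runs through the `2 ^ d` fields of 16
digits of `C`. -/
noncomputable def spread (w : ℕ) (f : ℕ → ℕ) (d : ℕ) : ℕ → ℕ :=
  Nat.rec (motive := fun _ => ℕ → ℕ) (fun C => Nat.mod (f (field 16 C 0)) (Nat.pow 2 w))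
    (fun d ih C => force (Nat.pow 2 d) fun p =>
      Nat.lor (force (Nat.mod C (Nat.pow 2 (Nat.mul 16 p))) ih)
        (Nat.shiftLeft (force (Nat.shiftRight C (Nat.mul 16 p)) ih) (Nat.mul w p))) d

theorem spread_succ (w : ℕ) (f : ℕ → ℕ) (d C : ℕ) :
    spread w f (d + 1) C = spread w f d (C % 2 ^ (16 * 2 ^ d)) |||
      spread w f d (C >>> (16 * 2 ^ d)) <<< (w * 2 ^ d) := by
  unfold spread
  simp only [force_eq, nat_ops]

theorem spread_lt (w : ℕ) (f : ℕ → ℕ) (d C : ℕ) : spread w f d C < 2 ^ (w * 2 ^ d) := by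
  induction d generalizing C with
  | zero =>
    rw [pow_zero, mul_one]
    exact Nat.mod_lt _ (Nat.two_pow_pos w)
  | succ d ih =>
    rw [spread_succ]
    have h : w * 2 ^ (d + 1) = w * 2 ^ d + w * 2 ^ d := by ring
    refine Nat.or_lt_two_pow ((ih _).trans_le (Nat.pow_le_pow_right two_pos (by omega))) ?_
    rw [Nat.shiftLeft_eq, h, pow_add]
    exact Nat.mul_lt_mul_of_pos_right (ih _) (Nat.two_pow_pos _)

theorem testBit_spread (w : ℕ) (f : ℕ → ℕ) {d i j : ℕ} (C : ℕ) (hi : i < 2 ^ d) (hj : j < w) :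
    (spread w f d C).testBit (w * i + j) = (f (field 16 C i)).testBit j := by
  induction d generalizing C i with
  | zero =>
    obtain rfl : i = 0 := by simpa using hi
    have : spread w f 0 C = f (field 16 C 0) % 2 ^ w := rfl
    rw [this, Nat.testBit_mod_two_pow]
    simp [hj]
  | succ d ih =>
    rw [spread_succ, Nat.testBit_or, Nat.testBit_shiftLeft]
    rcases lt_or_ge i (2 ^ d) with h | h
    · have : w * i + j < w * 2 ^ d :=
        calc w * i + j < w * i + w := by omega
          _ = w * (i + 1) := by ring
          _ ≤ w * 2 ^ d := Nat.mul_le_mul_left _ h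
      rw [ih _ h, field_mod _ _ h]
      simp [this]
    · obtain ⟨i, rfl⟩ := Nat.exists_eq_add_of_le h
      have hi' : i < 2 ^ d := by rw [pow_succ] at hi; omega
      rw [mul_add, show w * 2 ^ d + w * i + j - w * 2 ^ d = w * i + j by omega, ih _ hi',
        field_shiftRight, Nat.testBit_lt_two_pow ((spread_lt w f d _).trans_le
          (Nat.pow_le_pow_right two_pos (show w * 2 ^ d ≤ w * 2 ^ d + w * i + j by omega)))]
      simp [show w * 2 ^ d ≤ w * 2 ^ d + w * i + j by omega]

/-! ### Binary trees of fields -/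

/-- A tree whose leaves hold fields of three numerals, and whose nodes hold the positions of the
leaves to the left and to the right, as digits. -/
inductive FieldTree where
  | leaf (F B e N : ℕ)
  | node (ml mr : ℕ) (l r : FieldTree)

/-- Whether `k` holds at all leaves whose positions are digits of `D`. -/
noncomputable def FieldTree.visit (D : ℕ) (k : ℕ → ℕ → ℕ → ℕ → Bool) (t : FieldTree) : Bool :=
  FieldTree.rec (motive := fun _ => Bool) (fun F B e N => k F B e N)
    (fun ml mr _ _ vl vr => sel (sel (Nat.beq (Nat.land D ml) 0) true vl)
      (sel (Nat.beq (Nat.land D mr) 0) true vr) false) t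

/-- The tree of the fields of `C`, `F`, `B`, with positions starting at `o`. -/
noncomputable def buildTree (d : ℕ) : ℕ → ℕ → ℕ → ℕ → (FieldTree → Bool) → Bool :=
  Nat.rec (motive := fun _ => ℕ → ℕ → ℕ → ℕ → (FieldTree → Bool) → Bool)
    (fun C F B o k => force (field 16 C 0) fun C => force (field 1024 F 0) fun F =>
      force (field 1024 B 0) fun B => force (Nat.pow 2 o) fun e => k (.leaf F B e C))
    (fun d ih C F B o k => force (Nat.pow 2 d) fun p => force (Nat.mul 1024 p) fun wp =>
      force (Nat.mul 16 p) fun cp => force (Nat.pow 2 wp) fun m => force (Nat.pow 2 cp) fun mc =>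
      ih (Nat.mod C mc) (Nat.mod F m) (Nat.mod B m) o fun l =>
      ih (Nat.shiftRight C cp) (Nat.shiftRight F wp) (Nat.shiftRight B wp) (Nat.add o p) fun r =>
      force (Nat.shiftLeft (Nat.sub (Nat.pow 2 p) 1) (Nat.add 64 o)) fun ml =>
      force (Nat.shiftLeft (Nat.sub (Nat.pow 2 p) 1) (Nat.add 64 (Nat.add o p))) fun mr =>
      k (.node ml mr l r)) d

theorem and_shiftLeft_ne_zero {D o p i : ℕ} (hi : i < p) (h : D.testBit (o + i) = true) :
    Nat.beq (D &&& (2 ^ p - 1) <<< o) 0 = false := by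
  rw [← Bool.not_eq_true, Nat.beq_eq]
  intro h0
  have : (D &&& (2 ^ p - 1) <<< o).testBit (o + i) = true := by
    rw [Nat.testBit_and, h, Nat.testBit_shiftLeft, Nat.testBit_two_pow_sub_one]
    simp [hi]
  rw [h0, Nat.zero_testBit] at this
  exact absurd this (by simp)

theorem buildTree_eq (d C F B o : ℕ) : ∃ t : FieldTree, (∀ k, buildTree d C F B o k = k t) ∧
    ∀ D k, t.visit D k = true → ∀ i < 2 ^ d, D.testBit (64 + o + i) = true →
      k (field 1024 F i) (field 1024 B i) (2 ^ (o + i)) (field 16 C i) = true := by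
  induction d generalizing C F B o with
  | zero =>
    refine ⟨.leaf (field 1024 F 0) (field 1024 B 0) (2 ^ o) (field 16 C 0), fun k => ?_,
      fun D k h i hi _ => ?_⟩
    · unfold buildTree
      simp only [force_eq, nat_ops]
      rfl
    · obtain rfl : i = 0 := by simpa using hi
      exact h
  | succ d ih =>
    obtain ⟨l, hl, hl'⟩ := ih (C % 2 ^ (16 * 2 ^ d)) (F % 2 ^ (1024 * 2 ^ d))
      (B % 2 ^ (1024 * 2 ^ d)) o
    obtain ⟨r, hr, hr'⟩ := ih (C >>> (16 * 2 ^ d)) (F >>> (1024 * 2 ^ d)) (B >>> (1024 * 2 ^ d))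
      (o + 2 ^ d)
    refine ⟨.node ((2 ^ 2 ^ d - 1) <<< (64 + o)) ((2 ^ 2 ^ d - 1) <<< (64 + (o + 2 ^ d))) l r,
      fun k => ?_, fun D k h i hi hD => ?_⟩
    · have : buildTree (d + 1) C F B o k =
          buildTree d (C % 2 ^ (16 * 2 ^ d)) (F % 2 ^ (1024 * 2 ^ d)) (B % 2 ^ (1024 * 2 ^ d)) o
            fun l => buildTree d (C >>> (16 * 2 ^ d)) (F >>> (1024 * 2 ^ d))
              (B >>> (1024 * 2 ^ d)) (o + 2 ^ d) fun r => k (.node ((2 ^ 2 ^ d - 1) <<< (64 + o))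
                ((2 ^ 2 ^ d - 1) <<< (64 + (o + 2 ^ d))) l r) := by
        unfold buildTree
        simp only [force_eq, nat_ops]
      rw [this, hl, hr]
    · have hsel : ∀ {a b : Bool}, sel a b false = true → a = true ∧ b = true := by
        intro a b; cases a <;> simp
      obtain ⟨h1, h2⟩ := hsel h
      rcases lt_or_ge i (2 ^ d) with hi' | hi'
      · have h3 := and_shiftLeft_ne_zero hi' hD
        simp only [nat_ops] at h1
        rw [h3] at h1
        simpa only [field_mod _ _ hi'] using hl' D k h1 i hi' hD
      · obtain ⟨i, rfl⟩ := Nat.exists_eq_add_of_le hi'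
        have hi'' : i < 2 ^ d := by rw [pow_succ] at hi; omega
        have hD' : D.testBit (64 + (o + 2 ^ d) + i) = true := by
          rwa [show 64 + (o + 2 ^ d) + i = 64 + o + (2 ^ d + i) by omega]
        have h3 := and_shiftLeft_ne_zero hi'' hD'
        simp only [nat_ops] at h2
        rw [h3] at h2
        simpa only [field_shiftRight, add_assoc] using hr' D k h2 i hi'' hD'

/-! ### Rows from in-neighbours to twelve out-neighbours -/

/-- The arcs of `circ13`. -/
noncomputable def arc (i j : ℕ) : Bool := bit (circ13.getD i 0) j

/-- The number of nonzero digits of `N` among the first twelve. -/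
noncomputable def count (N : ℕ) : ℕ :=
  Nat.rec (motive := fun _ => ℕ) 0
    (fun i ih => Nat.add ih (Nat.mod (Nat.shiftRight N i) 2)) 12

/-- The possible rows from an in-neighbour to twelve out-neighbours that form `circ13`. -/
noncomputable def rowList : List ℕ :=
  (List.range 4096).filter fun N => sel (Nat.ble 4 (count N)) (sel (Nat.ble (count N) 7)
    (not (hasChainIn circ13 4 N)) false) false

/-- The elements of `l` in fields of 16 digits. -/
noncomputable def code (l : List ℕ) : ℕ :=
  List.rec (motive := fun _ => ℕ) 0 (fun N _ ih => Nat.add N (Nat.shiftLeft ih 16)) l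

/-- The elements of `rowList` in fields of 16 digits. -/
noncomputable def rowCode : ℕ := code rowList

/-- The chains of length three among the first twelve vertices of `circ13`. -/
noncomputable def triples : List (ℕ × ℕ × ℕ) :=
  (List.range 12).flatMap fun x => (List.range 12).flatMap fun y =>
    ((List.range 12).filter fun z => arc x y && arc x z && arc y z).map fun z => (x, y, z)

/-- The chains of length four among the first twelve vertices of `circ13`. -/
noncomputable def quadruples : List (ℕ × ℕ × ℕ × ℕ) :=
  triples.flatMap fun t => ((List.range 12).filter fun w =>
    arc t.1 w && arc t.2.1 w && arc t.2.2 w).map fun w => (t.1, t.2.1, t.2.2, w)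

/-- Whether in-neighbours `b` and `b'` of a vertex with `b → b'`, whose rows have the digits `r`
and `c`, are contained in a chain of length six with `triples` or `quadruples`. -/
noncomputable def clash (r c : ℕ → Bool) : Bool :=
  (triples.any fun t => r t.1 && c t.1 && (r t.2.1 && c t.2.1) && (r t.2.2 && c t.2.2)) ||
  quadruples.any fun t =>
    ((!r t.1 || r t.2.1) && (!c t.1 || c t.2.1)) &&
    ((!r t.2.1 || r t.2.2.1) && (!c t.2.1 || c t.2.2.1)) &&
    ((!r t.2.2.1 || r t.2.2.2) && (!c t.2.2.1 || c t.2.2.2)) &&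
    (((!c t.1 || r t.1) && (!c t.2.1 || r t.2.1)) &&
      ((!c t.2.2.1 || r t.2.2.1) && (!c t.2.2.2 || r t.2.2.2)))

/-- All digits of a table of digits indexed by pairs of candidates. -/
noncomputable def full : ℕ := Nat.sub (Nat.pow 2 1048576) 1

/-- The complementary table. -/
noncomputable def compl (n : ℕ) : ℕ := Nat.xor full n

/-- The table of `clash`, from the tables of the digits of the two rows. -/
noncomputable def clashTable (r c : ℕ → ℕ) : ℕ :=
  Nat.lor
    (List.rec (motive := fun _ => ℕ) 0 (fun t _ ih => force t.1 fun x => force t.2.1 fun y =>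
      force t.2.2 fun z => Nat.lor (Nat.land (Nat.land (Nat.land (r x) (c x))
        (Nat.land (r y) (c y))) (Nat.land (r z) (c z))) ih) triples)
    (List.rec (motive := fun _ => ℕ) 0 (fun t _ ih => force t.1 fun x => force t.2.1 fun y =>
      force t.2.2.1 fun z => force t.2.2.2 fun w => Nat.lor (Nat.land (Nat.land (Nat.land
        (Nat.land (Nat.lor (compl (r x)) (r y)) (Nat.lor (compl (c x)) (c y)))
        (Nat.land (Nat.lor (compl (r y)) (r z)) (Nat.lor (compl (c y)) (c z))))
        (Nat.land (Nat.lor (compl (r z)) (r w)) (Nat.lor (compl (c z)) (c w))))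
        (Nat.land (Nat.land (Nat.lor (compl (c x)) (r x)) (Nat.lor (compl (c y)) (r y)))
          (Nat.land (Nat.lor (compl (c z)) (r z)) (Nat.lor (compl (c w)) (r w))))) ih) quadruples)

theorem testBit_pow_sub_one (m p : ℕ) :
    (Nat.sub (Nat.pow 2 m) 1).testBit p = decide (p < m) := by
  simp only [nat_ops]
  exact Nat.testBit_two_pow_sub_one m p

theorem testBit_full {p : ℕ} (hp : p < 1048576) : full.testBit p = true := by
  unfold full
  rw [testBit_pow_sub_one]
  exact decide_eq_true hp

theorem testBit_compl {n p : ℕ} (hp : p < 1048576) : (compl n).testBit p = !n.testBit p := by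
  unfold compl
  simp only [nat_ops]
  rw [Nat.testBit_xor, testBit_full hp, Bool.true_xor]

theorem testBit_clashTable {r c : ℕ → ℕ} {p : ℕ} (hp : p < 1048576) :
    (clashTable r c).testBit p =
      clash (fun x => (r x).testBit p) (fun x => (c x).testBit p) := by
  unfold clashTable clash
  simp only [nat_ops]
  rw [Nat.testBit_or]
  congr 1
  · induction triples with
    | nil => simp
    | cons t l ih =>
      simp only [force_eq] at ih ⊢
      rw [List.any_cons, Nat.testBit_or, ← ih]
      simp only [Nat.testBit_and]
  · induction quadruples with
    | nil => simp
    | cons t l ih =>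
      simp only [force_eq] at ih ⊢
      rw [List.any_cons, Nat.testBit_or, ← ih]
      simp only [Nat.testBit_and, Nat.testBit_or, testBit_compl hp]

/-- The table of the `c`-th digit of the first row. -/
noncomputable def rowTable (C c : ℕ) : ℕ :=
  spread 1024 (fun N => sel (bit N c) (Nat.sub (Nat.pow 2 1024) 1) 0) 10 C

/-- The table of the `c`-th digit of the second row. -/
noncomputable def colTable (C c : ℕ) : ℕ :=
  force (spread 1 (fun N => sel (bit N c) 1 0) 10 C) fun m => spread 1024 (fun _ => m) 10 C

theorem testBit_spread_one (p : ℕ → Bool) (C : ℕ) {i : ℕ} (hi : i < 1024) :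
    (spread 1 (fun N => sel (p N) 1 0) 10 C).testBit i = p (field 16 C i) := by
  have := testBit_spread 1 (fun N => sel (p N) 1 0) C (d := 10) (by simpa using hi) zero_lt_one
  rw [one_mul, add_zero] at this
  rw [this]
  cases p (field 16 C i) <;> simp

theorem testBit_rowTable (C c : ℕ) {i j : ℕ} (hi : i < 1024) (hj : j < 1024) :
    (rowTable C c).testBit (1024 * i + j) = (field 16 C i).testBit c := by
  rw [rowTable, testBit_spread _ _ _ (by simpa using hi) hj, bit_eq]
  cases (field 16 C i).testBit c with
  | true => rw [sel_true, testBit_pow_sub_one]; exact decide_eq_true hj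
  | false => simp

theorem testBit_colTable (C c : ℕ) {i j : ℕ} (hi : i < 1024) (hj : j < 1024) :
    (colTable C c).testBit (1024 * i + j) = (field 16 C j).testBit c := by
  rw [colTable, force_eq, testBit_spread _ _ _ (by simpa using hi) hj, testBit_spread_one _ _ hj,
    bit_eq]

/-! ### Search for the rows of twelve in-neighbours -/

/-- Factors that distribute the rows of the tables to the fields for the neighbours of `b`. -/
structure Step where
  /-- the factor for the out-neighbours -/
  out : ℕ
  /-- the factor for the in-neighbours -/
  inn : ℕ
  /-- the factor for `b` itself -/
  self : ℕ
  /-- the number `b` -/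
  b : ℕ

/-- The factors for `b`, which leave out the 64 lowest digits. -/
noncomputable def mkStep (b : ℕ) : Step where
  out := concat 1024 (fun x => sel (arc b x) (Nat.pow 2 64) 0) 12
  inn := concat 1024 (fun x => sel (arc x b) (Nat.pow 2 64) 0) 12
  self := concat 1024 (fun x => sel (Nat.beq x b) (Nat.pow 2 64) 0) 12
  b := b

/-- `k (l.map mkStep)`, with all factors evaluated to numerals. -/
noncomputable def withSteps (l : List ℕ) : (List Step → Bool) → Bool :=
  List.rec (motive := fun _ => (List Step → Bool) → Bool) (fun k => k [])
    (fun b _ ih k => ih fun vs => force (mkStep b).out fun P => force (mkStep b).inn fun Q =>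
      force (mkStep b).self fun R => force (mkStep b).b fun b => k (⟨P, Q, R, b⟩ :: vs)) l

/-- Choose a row for each of `vs` in turn from the field of `S` for it, reduce the other fields to
the rows that do not clash with it, and check `leaf` for the rows chosen. The 64 lowest digits
of `S` only serve to make the low digits of different values differ. -/
noncomputable def assign (t : FieldTree) (one car : ℕ) (leaf : List ℕ → Bool) (vs : List Step) :
    ℕ → List ℕ → Bool :=
  List.rec (motive := fun _ => ℕ → List ℕ → Bool) (fun _ acc => leaf acc)
    (fun v _ ih S acc =>
      force (Nat.add (Nat.shiftLeft (field 1024 (Nat.shiftRight S 64) v.b) 64)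
        (Nat.mod S 18446744073709551616)) fun D =>
      t.visit D fun F B e N =>
        force (Nat.add (Nat.land S (Nat.add (Nat.add (Nat.mul F v.out) (Nat.mul B v.inn))
            (Nat.mul e v.self)))
          (Nat.mod (Nat.add (Nat.mul (Nat.mod S 18446744073709551616) 1000003) N)
            2305843009213693951)) fun S' =>
        sel (Nat.beq (Nat.land (Nat.add S' one) car) car) (ih S' (N :: acc)) true) vs

/-- `S` has a field for each of twelve in-neighbours `b`, with the digit `idx b`. -/
def Admits (idx : ℕ → ℕ) (S : ℕ) : Prop :=
  ∃ (f : ℕ → ℕ) (low : ℕ), low < 2 ^ 64 ∧ S = 2 ^ 64 * concat 1024 f 12 + low ∧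
    ∀ b < 12, f b < 2 ^ 1023 ∧ (f b).testBit (idx b) = true

theorem two_pow_mul_add_and {k x l y : ℕ} (h : l < 2 ^ k) :
    (2 ^ k * x + l) &&& (2 ^ k * y) = 2 ^ k * (x &&& y) := by
  refine Nat.eq_of_testBit_eq fun j => ?_
  rw [Nat.testBit_and, Nat.testBit_two_pow_mul_add _ h, Nat.testBit_two_pow_mul,
    Nat.testBit_two_pow_mul, Nat.testBit_and]
  by_cases hj : j < k
  · simp [hj, not_le.2 hj]
  · simp [hj, not_lt.1 hj]

theorem concat_add_and {m n : ℕ} {f : ℕ → ℕ} (hf : ∀ i < n, f i < 2 ^ m ∧ f i ≠ 0) :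
    (concat (m + 1) f n + concat (m + 1) (fun _ => 2 ^ m - 1) n) &&&
      concat (m + 1) (fun _ => 2 ^ m) n = concat (m + 1) (fun _ => 2 ^ m) n := by
  have hpow : 2 ^ (m + 1) = 2 ^ m + 2 ^ m := by rw [pow_succ, mul_two]
  have hpos : 0 < 2 ^ m := Nat.two_pow_pos m
  rw [concat_add, concat_and (Nat.succ_pos m)
    (fun i hi => by have := (hf i hi).1; omega) (fun i _ => by omega)]
  refine concat_congr fun i hi => ?_
  obtain ⟨h1, h2⟩ := hf i hi
  rw [Nat.and_two_pow, Nat.testBit_of_two_pow_le_and_two_pow_add_one_gt (i := m) (by omega)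
    (by omega)]
  simp

theorem Admits.test {idx : ℕ → ℕ} {S : ℕ} (h : Admits idx S) :
    Nat.beq ((S + 2 ^ 64 * concat 1024 (fun _ => 2 ^ 1023 - 1) 12) &&&
      (2 ^ 64 * concat 1024 (fun _ => 2 ^ 1023) 12))
      (2 ^ 64 * concat 1024 (fun _ => 2 ^ 1023) 12) = true := by
  obtain ⟨f, low, hlow, rfl, hf⟩ := h
  have := concat_add_and (m := 1023) fun i hi =>
    ⟨(hf i hi).1, fun h => by simpa [h] using (hf i hi).2⟩
  rw [Nat.beq_eq, add_right_comm, ← mul_add, two_pow_mul_add_and hlow, this]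

theorem arc_trichotomy : ∀ b < 12, ∀ x < 12, (arc b x = true → arc x b = false ∧ x ≠ b) ∧
    (arc x b = true → x ≠ b) ∧ (arc b x = false → arc x b = false → x = b) := by
  decide +kernel

theorem step_eq (F B e : ℕ) {b : ℕ} (hb : b < 12) :
    F * (mkStep b).out + B * (mkStep b).inn + e * (mkStep b).self =
      2 ^ 64 * concat 1024 (fun x => sel (arc b x) F (sel (arc x b) B (sel (Nat.beq x b) e 0)))
        12 := by
  simp only [mkStep]
  rw [mul_concat, mul_concat, mul_concat, concat_add, concat_add, mul_concat]
  refine concat_congr fun x hx => ?_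
  have h := arc_trichotomy b hb x hx
  cases h1 : arc b x with
  | true =>
    have h2 := (h.1 h1).1
    have h3 : Nat.beq x b = false := by
      rw [← Bool.not_eq_true, Nat.beq_eq]
      exact (h.1 h1).2
    simp [h2, h3, mul_comm]
  | false =>
    cases h2 : arc x b with
    | true =>
      have h3 : Nat.beq x b = false := by
        rw [← Bool.not_eq_true, Nat.beq_eq]
        exact h.2.1 h2
      simp [h3, mul_comm]
    | false =>
      cases h3 : Nat.beq x b <;> simp [mul_comm]

theorem withSteps_eq (l : List ℕ) (k : List Step → Bool) : withSteps l k = k (l.map mkStep) := by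
  induction l generalizing k with
  | nil => rfl
  | cons b l ih =>
    have : withSteps (b :: l) k = withSteps l fun vs => k (mkStep b :: vs) := by
      unfold withSteps
      simp only [force_eq]
    rw [this, ih, List.map_cons]

theorem assign_sound {C TF TB : ℕ} {t : FieldTree}
    (ht : ∀ D k, t.visit D k = true → ∀ i < 2 ^ 10, D.testBit (64 + 0 + i) = true →
      k (field 1024 TF i) (field 1024 TB i) (2 ^ (0 + i)) (field 16 C i) = true)
    (hTF : ∀ i < 1024, ∀ j < 1024, TF.testBit (1024 * i + j) =
      !clash (field 16 C i).testBit (field 16 C j).testBit)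
    (hTB : ∀ i < 1024, ∀ j < 1024, TB.testBit (1024 * i + j) =
      !clash (field 16 C j).testBit (field 16 C i).testBit)
    {N idx : ℕ → ℕ} (hidx : ∀ b < 12, idx b < 1023 ∧ field 16 C (idx b) = N b)
    (hN : ∀ b < 12, ∀ x < 12, arc b x = true → clash (N b).testBit (N x).testBit = false)
    {leaf : List ℕ → Bool} {l : List ℕ} (hl : ∀ b ∈ l, b < 12) {S : ℕ} (hS : Admits idx S)
    {one car : ℕ} (hone : 2 ^ 64 * concat 1024 (fun _ => 2 ^ 1023 - 1) 12 = one)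
    (hcar : 2 ^ 64 * concat 1024 (fun _ => 2 ^ 1023) 12 = car) {acc : List ℕ}
    (h : assign t one car leaf (l.map mkStep) S acc = true) :
    leaf ((l.map N).reverse ++ acc) = true := by
  induction l generalizing S acc with
  | nil => exact h
  | cons b l ih =>
    have hb := hl b (by simp)
    have key : assign t one car leaf ((b :: l).map mkStep) S acc =
        t.visit (field 1024 (S >>> 64) b <<< 64 + S % 18446744073709551616) fun F B e N =>
          force ((S &&& (F * (mkStep b).out + B * (mkStep b).inn + e * (mkStep b).self)) +
            (S % 18446744073709551616 * 1000003 + N) % 2305843009213693951) fun S' =>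
          sel (Nat.beq ((S' + one) &&& car) car)
            (assign t one car leaf (l.map mkStep) S' (N :: acc)) true := by
      unfold assign
      simp only [force_eq, nat_ops]
      rfl
    rw [key] at h
    obtain ⟨f, low, hlow, rfl, hf⟩ := hS
    have hf' : ∀ i < 12, f i < 2 ^ 1024 := fun i hi =>
      (hf i hi).1.trans_le (Nat.pow_le_pow_right two_pos (by norm_num))
    have hshift : (2 ^ 64 * concat 1024 f 12 + low) >>> 64 = concat 1024 f 12 := by
      rw [Nat.shiftRight_eq_div_pow, Nat.mul_add_div (Nat.two_pow_pos _), Nat.div_eq_of_lt hlow,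
        add_zero]
    have hD : (field 1024 ((2 ^ 64 * concat 1024 f 12 + low) >>> 64) b <<< 64 +
        (2 ^ 64 * concat 1024 f 12 + low) % 18446744073709551616).testBit (64 + 0 + idx b) =
          true := by
      rw [hshift, field_concat hf' hb, Nat.shiftLeft_eq, mul_comm (f b),
        Nat.testBit_two_pow_mul_add _ (Nat.mod_lt _ (by norm_num))]
      simp [(hf b hb).2]
    have h1 := ht _ _ h (idx b) (by have := (hidx b hb).1; norm_num; omega) hD
    rw [(hidx b hb).2, step_eq _ _ _ hb, force_eq, two_pow_mul_add_and hlow] at h1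
    set g : ℕ → ℕ := fun x => sel (arc b x) (field 1024 TF (idx b)) (sel (arc x b)
      (field 1024 TB (idx b)) (sel (Nat.beq x b) (2 ^ (0 + idx b)) 0)) with hg
    have hgx : ∀ x < 12, g x < 2 ^ 1024 ∧ (g x).testBit (idx x) = true := by
      intro x hx
      have hb' := (hidx b hb).1
      have hx' := (hidx x hx).1
      simp only [hg]
      cases h2 : arc b x with
      | true =>
        refine ⟨field_lt _ _ _, ?_⟩
        rw [sel_true, testBit_field, hTF _ (by omega) _ (by omega), (hidx b hb).2, (hidx x hx).2,
          hN b hb x hx h2]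
        simp
        omega
      | false =>
        cases h3 : arc x b with
        | true =>
          refine ⟨field_lt _ _ _, ?_⟩
          rw [sel_false, sel_true, testBit_field, hTB _ (by omega) _ (by omega), (hidx b hb).2,
            (hidx x hx).2, hN x hx b hb h3]
          simp
          omega
        | false =>
          obtain rfl := (arc_trichotomy b hb x hx).2.2 h2 h3
          have h4 : Nat.beq x x = true := Nat.beq_refl x
          rw [sel_false, sel_false, h4, sel_true, zero_add]
          exact ⟨Nat.pow_lt_pow_right one_lt_two (by omega), Nat.testBit_two_pow_self⟩
    rw [concat_and (by norm_num) hf' fun i hi => (hgx i hi).1] at h1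
    have hS' : Admits idx (2 ^ 64 * concat 1024 (fun i => f i &&& g i) 12 +
        ((2 ^ 64 * concat 1024 f 12 + low) % 18446744073709551616 * 1000003 + N b) %
          2305843009213693951) := by
      refine ⟨_, _, (Nat.mod_lt _ (by norm_num)).trans (by norm_num), rfl, fun x hx =>
        ⟨Nat.and_le_left.trans_lt (hf x hx).1, ?_⟩⟩
      rw [Nat.testBit_and, (hf x hx).2, (hgx x hx).2, Bool.and_self]
    have htest := hS'.test
    rw [hone, hcar] at htest
    rw [htest, sel_true] at h1
    have := ih (fun b hb => hl b (by simp [hb])) hS' h1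
    simpa using this

/-- The elements `N` of the list in `C` for which an in-neighbour with row `N` has an admissible
degree, when it has `q` out-neighbours among the twelve in-neighbours. -/
noncomputable def domain (C q : ℕ) : ℕ :=
  Nat.mod (spread 1 (fun N => sel (sel (Nat.ble 10 (Nat.add (count N) q))
    (Nat.ble (Nat.add (count N) q) 12) false) 1 0) 10 C) (Nat.pow 2 1023)

/-- The row of the automorphism `x ↦ 3 x + 2` of `circ13` applied to a row. -/
noncomputable def rot (N : ℕ) : ℕ :=
  concat 1 (fun i => sel (bit N (Nat.mod (Nat.add (Nat.mul 3 i) 2) 13)) 1 0) 12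

/-- Whether `N` is the smallest row in its orbit under `rot`. -/
noncomputable def canon (N : ℕ) : Bool :=
  force (rot N) fun M => sel (Nat.ble N M) (Nat.ble N (rot M)) false

/-- The order in which the rows of the in-neighbours are chosen. -/
def order : List ℕ := [6, 11, 7, 5, 2, 10, 4, 1, 3, 8, 9, 0]

/-- The positions in the reversed `order`. -/
def position : List ℕ := [0, 4, 7, 3, 5, 8, 11, 9, 2, 1, 6, 10]

/-- The rows from the remaining in-neighbours in a tournament on 27 vertices. -/
def paleyRows : List ℕ :=
  [1562, 3125, 1377, 213, 2736, 3416, 1414, 2154, 2829, 2755, 1708, 427, 854]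

/-- The arcs in the tournament formed by twelve out-neighbours, twelve in-neighbours with the rows
in `acc`, and a vertex. -/
noncomputable def glueArc (N : ℕ → ℕ) (i j : ℕ) : Bool :=
  sel (Nat.blt i 12)
    (sel (Nat.blt j 12) (arc i j)
      (sel (Nat.blt j 24) (not (bit (N (Nat.sub j 12)) i)) false))
    (sel (Nat.blt i 24)
      (sel (Nat.blt j 12) (bit (N (Nat.sub i 12)) j)
        (sel (Nat.blt j 24) (arc (Nat.sub i 12) (Nat.sub j 12)) true))
      (Nat.blt j 12))

/-- The rows of the tournament with the arcs `glueArc N`. -/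
noncomputable def glue (N : ℕ → ℕ) : List ℕ :=
  (List.range 25).map fun i => concat 1 (fun j => sel (glueArc N i j) 1 0) 25

/-- Whether the rows chosen are those of a particular tournament, or yield a chain of
length six. -/
noncomputable def leaf (acc : List ℕ) : Bool :=
  sel (acc.all fun N => paleyRows.any fun M => Nat.beq M N) true
    (hasChain (glue fun b => acc.getD (position.getD b 0) 0) 6)

/-- The search for the rows of twelve in-neighbours, where the row of the first one in `order`
satisfies `p`. -/
noncomputable def run (p : ℕ → Bool) : Bool :=
  force rowCode fun C => force (domain C 6) fun d6 => force (domain C 5) fun d5 =>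
  force (Nat.land d5 (spread 1 (fun N => sel (p N) 1 0) 10 C)) fun d =>
  force (concat 1024 (fun b => sel (Nat.beq b 6) d
    (sel (Nat.beq (count (circ13.getD b 0)) 6) d6 d5)) 12) fun S =>
  force (compl (clashTable (rowTable C) (colTable C))) fun F =>
  force (compl (clashTable (colTable C) (rowTable C))) fun B =>
  buildTree 10 C F B 0 fun t =>
  force (Nat.shiftLeft (concat 1024 (fun _ => Nat.sub (Nat.pow 2 1023) 1) 12) 64) fun one =>
  force (Nat.shiftLeft (concat 1024 (fun _ => Nat.pow 2 1023) 12) 64) fun car =>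
  withSteps order fun vs =>
  assign t one car leaf vs (Nat.add (Nat.shiftLeft S 64) 1) []

/-- The smallest rows in their orbits, from `lo` up to `hi`. -/
noncomputable def canonBetween (lo hi N : ℕ) : Bool :=
  sel (canon N) (sel (Nat.ble lo N) (Nat.blt N hi) false) false

theorem field_code {l : List ℕ} (hl : ∀ N ∈ l, N < 2 ^ 16) (i : ℕ) :
    field 16 (code l) i = l.getD i 0 := by
  induction l generalizing i with
  | nil => simp [code, field, nat_ops]
  | cons N l ih =>
    have h1 := hl N (by simp)
    have key : code (N :: l) = 2 ^ 16 * code l + N := by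
      rw [mul_comm, add_comm, ← Nat.shiftLeft_eq]
      rfl
    refine Nat.eq_of_testBit_eq fun j => ?_
    rw [testBit_field, key, Nat.testBit_two_pow_mul_add _ h1]
    cases i with
    | zero =>
      by_cases hj : j < 16
      · simp [hj]
      · simp [hj, Nat.testBit_lt_two_pow (h1.trans_le (Nat.pow_le_pow_right two_pos
          (not_lt.1 hj)))]
    | succ i =>
      rw [List.getD_cons_succ, ← ih (fun M hM => hl M (by simp [hM])), testBit_field,
        if_neg (by omega), show 16 * (i + 1) + j - 16 = 16 * i + j by omega]

theorem mem_rowList {N : ℕ} : N ∈ rowList ↔ N < 4096 ∧ 4 ≤ count N ∧ count N ≤ 7 ∧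
    hasChainIn circ13 4 N = false := by
  have hsel : ∀ {a b : Bool}, sel a b false = true ↔ a = true ∧ b = true := by
    intro a b; cases a <;> simp
  rw [rowList, List.mem_filter, List.mem_range, hsel, hsel, Nat.ble_eq, Nat.ble_eq,
    Bool.not_eq_true']

theorem field_rowCode (i : ℕ) : field 16 rowCode i = rowList.getD i 0 :=
  field_code (fun _ hN => (mem_rowList.1 hN).1.trans (by norm_num)) i

theorem length_rowList : rowList.length ≤ 1000 := Nat.le_of_ble_eq_true (by decide +kernel)

theorem testBit_domain {q i : ℕ} (hi : i < 1023) (h1 : 10 ≤ count (field 16 rowCode i) + q)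
    (h2 : count (field 16 rowCode i) + q ≤ 12) : (domain rowCode q).testBit i = true := by
  unfold domain
  simp only [nat_ops]
  rw [Nat.testBit_mod_two_pow, testBit_spread_one _ _ (by omega), Nat.ble_eq_true_of_le h1,
    Nat.ble_eq_true_of_le h2, decide_eq_true hi]
  rfl

theorem run_sound {p : ℕ → Bool} (h : run p = true) {N : ℕ → ℕ} (hN : ∀ b < 12, N b ∈ rowList)
    (hcount : ∀ b < 12, 10 ≤ count (N b) + count (circ13.getD b 0) ∧
      count (N b) + count (circ13.getD b 0) ≤ 12)
    (hclash : ∀ b < 12, ∀ x < 12, arc b x = true → clash (N b).testBit (N x).testBit = false)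
    (hp : p (N 6) = true) : leaf (order.map N).reverse = true := by
  have hidx : ∀ b, ∃ i, b < 12 → i < 1023 ∧ field 16 rowCode i = N b := by
    intro b
    by_cases hb : b < 12
    · obtain ⟨i, hi, he⟩ := List.getElem_of_mem (hN b hb)
      refine ⟨i, fun _ => ⟨by have := length_rowList; omega, ?_⟩⟩
      rw [field_rowCode, List.getD_eq_getElem _ _ hi, he]
    · exact ⟨0, fun h => absurd h hb⟩
  choose idx hidx using hidx
  unfold run at h
  simp only [force_eq] at h
  obtain ⟨t, hbuild, ht⟩ := buildTree_eq 10 rowCode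
    (compl (clashTable (rowTable rowCode) (colTable rowCode)))
    (compl (clashTable (colTable rowCode) (rowTable rowCode))) 0
  rw [hbuild, withSteps_eq] at h
  have hF : ∀ i < 1024, ∀ j < 1024,
      (compl (clashTable (rowTable rowCode) (colTable rowCode))).testBit (1024 * i + j) =
        !clash (field 16 rowCode i).testBit (field 16 rowCode j).testBit := by
    intro i hi j hj
    rw [testBit_compl (by omega), testBit_clashTable (by omega)]
    simp only [testBit_rowTable _ _ hi hj, testBit_colTable _ _ hi hj]
  have hB : ∀ i < 1024, ∀ j < 1024,
      (compl (clashTable (colTable rowCode) (rowTable rowCode))).testBit (1024 * i + j) =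
        !clash (field 16 rowCode j).testBit (field 16 rowCode i).testBit := by
    intro i hi j hj
    rw [testBit_compl (by omega), testBit_clashTable (by omega)]
    simp only [testBit_rowTable _ _ hi hj, testBit_colTable _ _ hi hj]
  have hdom : ∀ q, domain rowCode q < 2 ^ 1023 := fun q => Nat.mod_lt _ (Nat.two_pow_pos _)
  have hdeg : ∀ b < 12, count (circ13.getD b 0) =
      sel (Nat.beq (count (circ13.getD b 0)) 6) 6 5 := by
    decide +kernel
  have hshift : ∀ g, Nat.shiftLeft (concat 1024 g 12) 64 = 2 ^ 64 * concat 1024 g 12 :=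
    fun g => (Nat.shiftLeft_eq _ _).trans (mul_comm _ _)
  simp only [hshift] at h
  simp only [nat_ops] at h
  generalize hf : (fun b => sel (Nat.beq b 6) (domain rowCode 5 &&&
    spread 1 (fun N => sel (p N) 1 0) 10 rowCode) (sel (Nat.beq (count (circ13.getD b 0)) 6)
      (domain rowCode 6) (domain rowCode 5))) = f at h
  have hS : Admits idx (2 ^ 64 * concat 1024 f 12 + 1) := by
    refine ⟨f, 1, by norm_num, rfl, fun b hb => ?_⟩
    subst hf
    obtain ⟨h1, h2⟩ := hidx b hb
    obtain ⟨h3, h4⟩ := hcount b hb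
    have h5 := hdeg b hb
    dsimp only
    rw [← h2] at h3 h4
    cases h6 : Nat.beq b 6 with
    | true =>
      obtain rfl := Nat.eq_of_beq_eq_true h6
      have h7 : count (circ13.getD 6 0) = 5 := by decide +kernel
      rw [h7] at h3 h4
      rw [sel_true]
      refine ⟨Nat.and_le_left.trans_lt (hdom 5), ?_⟩
      rw [Nat.testBit_and, testBit_domain h1 h3 h4, testBit_spread_one _ _ (by omega), h2, hp]
      rfl
    | false =>
      rw [sel_false]
      cases h7 : Nat.beq (count (circ13.getD b 0)) 6 with
      | true =>
        rw [h7, sel_true] at h5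
        rw [h5] at h3 h4
        rw [sel_true]
        exact ⟨hdom 6, testBit_domain h1 h3 h4⟩
      | false =>
        rw [h7, sel_false] at h5
        rw [h5] at h3 h4
        rw [sel_false]
        exact ⟨hdom 5, testBit_domain h1 h3 h4⟩
  generalize 2 ^ 64 * concat 1024 f 12 + 1 = S at h hS
  generalize hone : 2 ^ 64 * concat 1024 (fun _ => 2 ^ 1023 - 1) 12 = one at h
  generalize hcar : 2 ^ 64 * concat 1024 (fun _ => 2 ^ 1023) 12 = car at h
  have := assign_sound ht hF hB hidx hclash (by decide) hS hone hcar h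
  rwa [List.append_nil] at this

section

variable {V : Type u}

/-! ### Rows in a tournament without chains of length six -/

theorem mem_triples {x y z : ℕ} : (x, y, z) ∈ triples ↔ x < 12 ∧ y < 12 ∧ z < 12 ∧
    arc x y = true ∧ arc x z = true ∧ arc y z = true := by
  simp [triples]
  tauto

theorem mem_quadruples {x y z w : ℕ} : (x, y, z, w) ∈ quadruples ↔ (x, y, z) ∈ triples ∧
    w < 12 ∧ arc x w = true ∧ arc y w = true ∧ arc z w = true := by
  simp [quadruples]
  tauto

theorem forall_imp_of_pairwise {r : V → V → Prop} (hr : IsTournament r) {p : V → Prop}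
    {l : List V} (hl : l.Pairwise r) (h : l.Pairwise fun x y => p x → p y) :
    ∀ x ∈ l, ∀ y ∈ l, r x y → p x → p y := by
  induction l with
  | nil => simp
  | cons a l ih =>
    rw [List.pairwise_cons] at hl h
    intro x hx y hy hxy hpx
    rcases List.mem_cons.1 hx with rfl | hx
    · rcases List.mem_cons.1 hy with rfl | hy
      exacts [hpx, h.1 y hy hpx]
    · rcases List.mem_cons.1 hy with h' | hy
      · exact absurd (h' ▸ hxy) (hr.asymm (hl.1 x hx))
      · exact ih hl.2 h.2 x hx y hy hxy hpx

theorem exists_pairwise_insert {r : V → V → Prop} (hr : IsTournament r) {l : List V}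
    (hl : l.Pairwise r) {b : V} (hb : b ∉ l) (h : ∀ x ∈ l, ∀ y ∈ l, r x y → r b x → r b y) :
    ∃ l' : List V, l'.Perm (b :: l) ∧ l'.Pairwise r := by
  induction l with
  | nil => exact ⟨[b], List.Perm.refl _, by simp⟩
  | cons a l ih =>
    rw [List.pairwise_cons] at hl
    rw [List.mem_cons, not_or] at hb
    by_cases hba : r b a
    · refine ⟨b :: a :: l, List.Perm.refl _, List.pairwise_cons.2 ⟨?_, List.pairwise_cons.2 hl⟩⟩
      intro y hy
      rcases List.mem_cons.1 hy with rfl | hy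
      exacts [hba, h a (by simp) y (by simp [hy]) (hl.1 y hy) hba]
    · obtain ⟨l', hl', hp⟩ := ih hl.2 hb.2 fun x hx y hy => h x (by simp [hx]) y (by simp [hy])
      refine ⟨a :: l', (hl'.cons a).trans (List.Perm.swap b a l), List.pairwise_cons.2 ⟨?_, hp⟩⟩
      intro y hy
      rcases List.mem_cons.1 (hl'.mem_iff.1 hy) with rfl | hy
      exacts [(hr.not_rel_iff hb.1).1 hba, hl.1 y hy]

/-- In-neighbours `b`, `c` of the vertices of a chain inserted into it. -/
theorem ChainFree.not_insert_insert {r : V → V → Prop} (hr : IsTournament r) {l : List V}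
    (h : ChainFree r (l.length + 2) Set.univ) (hl : l.Pairwise r) {b c : V} (hbc : r b c)
    (hb : b ∉ l) (hc : c ∉ l) (hbl : l.Pairwise fun x y => r b x → r b y)
    (hcl : l.Pairwise fun x y => r c x → r c y) : ¬ ∀ x ∈ l, r c x → r b x := by
  intro hcb
  obtain ⟨l₁, h₁, hp₁⟩ := exists_pairwise_insert hr hl hc (forall_imp_of_pairwise hr hl hcl)
  have hb₁ : b ∉ l₁ := by
    rw [h₁.mem_iff, List.mem_cons, not_or]
    exact ⟨hr.ne_of_rel hbc, hb⟩
  obtain ⟨l₂, h₂, hp₂⟩ := exists_pairwise_insert hr hp₁ hb₁ fun x hx y hy hxy hbx => by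
    rcases List.mem_cons.1 (h₁.mem_iff.1 hy) with rfl | hy
    · exact hbc
    · rcases List.mem_cons.1 (h₁.mem_iff.1 hx) with rfl | hx
      exacts [hcb y hy hxy, forall_imp_of_pairwise hr hl hbl x hx y hy hxy hbx]
  exact h l₂ (by simp [h₂.length_eq, h₁.length_eq]) hp₂ fun _ _ => Set.mem_univ _

/-- A vertex `v` of a tournament with twelve out-neighbours `φ` and twelve in-neighbours `χ`, which
both form `circ13`, where the digits of `N b` record the out-neighbours of `χ b` among `φ`. -/
structure Config (r : V → V → Prop) (v : V) (φ χ : Fin 12 → V) (N : ℕ → ℕ) : Prop where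
  out (i : Fin 12) : r v (φ i)
  inn (b : Fin 12) : r (χ b) v
  injective_out : Function.Injective φ
  injective_inn : Function.Injective χ
  realizes_out : Realizes r φ circ13
  realizes_inn : Realizes r χ circ13
  lt (b : Fin 12) : N b < 4096
  row (b i : Fin 12) : (N b).testBit i = true ↔ r (χ b) (φ i)

namespace Config

variable {r : V → V → Prop} {v : V} {φ χ : Fin 12 → V} {N : ℕ → ℕ}

theorem rel_out_iff (c : Config r v φ χ N) (i j : Fin 12) : r (φ i) (φ j) ↔ arc i j = true := by
  rw [arc, bit_eq]
  exact c.realizes_out i j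

theorem rel_inn_iff (c : Config r v φ χ N) (b b' : Fin 12) :
    r (χ b) (χ b') ↔ arc b b' = true := by
  rw [arc, bit_eq]
  exact c.realizes_inn b b'

theorem out_ne_inn (c : Config r v φ χ N) (hr : IsTournament r) (i b : Fin 12) : χ b ≠ φ i := by
  intro h
  exact hr.asymm (c.out i) (h ▸ c.inn b)

theorem clash_eq_false (c : Config r v φ χ N) (hr : IsTournament r)
    (h : ChainFree r 6 Set.univ) {b b' : ℕ} (hb : b < 12) (hb' : b' < 12)
    (hbb' : arc b b' = true) : clash (N b).testBit (N b').testBit = false := by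
  have hrel := (c.rel_inn_iff ⟨b, hb⟩ ⟨b', hb'⟩).2 hbb'
  have arcs : ∀ {x y : ℕ} (hx : x < 12) (hy : y < 12), arc x y = true →
      r (φ ⟨x, hx⟩) (φ ⟨y, hy⟩) := fun hx hy => (c.rel_out_iff ⟨_, hx⟩ ⟨_, hy⟩).2
  have rows : ∀ {x : ℕ} (hx : x < 12), (N b).testBit x = true ↔ r (χ ⟨b, hb⟩) (φ ⟨x, hx⟩) :=
    fun hx => c.row ⟨b, hb⟩ ⟨_, hx⟩
  have rows' : ∀ {x : ℕ} (hx : x < 12), (N b').testBit x = true ↔ r (χ ⟨b', hb'⟩) (φ ⟨x, hx⟩) :=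
    fun hx => c.row ⟨b', hb'⟩ ⟨_, hx⟩
  rw [← Bool.not_eq_true, clash, Bool.or_eq_true, not_or, List.any_eq_true, List.any_eq_true]
  constructor
  · rintro ⟨⟨x, y, z⟩, ht, hd⟩
    obtain ⟨hx, hy, hz, hxy, hxz, hyz⟩ := mem_triples.1 ht
    simp only [Bool.and_eq_true, rows hx, rows hy, rows hz, rows' hx, rows' hy, rows' hz] at hd
    refine h [χ ⟨b, hb⟩, χ ⟨b', hb'⟩, v, φ ⟨x, hx⟩, φ ⟨y, hy⟩, φ ⟨z, hz⟩] rfl ?_ fun _ _ =>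
      Set.mem_univ _
    simp only [List.pairwise_cons, List.mem_cons, forall_eq_or_imp, List.not_mem_nil,
      false_imp_iff, implies_true, and_true, List.Pairwise.nil]
    exact ⟨⟨hrel, c.inn _, hd.1.1.1, hd.1.2.1, hd.2.1⟩, ⟨c.inn _, hd.1.1.2, hd.1.2.2, hd.2.2⟩,
      ⟨c.out _, c.out _, c.out _⟩, ⟨arcs hx hy hxy, arcs hx hz hxz⟩, arcs hy hz hyz⟩
  · rintro ⟨⟨x, y, z, w⟩, ht, hd⟩
    obtain ⟨ht, hw, hxw, hyw, hzw⟩ := mem_quadruples.1 ht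
    obtain ⟨hx, hy, hz, hxy, hxz, hyz⟩ := mem_triples.1 ht
    have himp : ∀ {p q : Bool}, (!p || q) = true ↔ (p = true → q = true) := by decide
    simp only [Bool.and_eq_true, himp, rows hx, rows hy, rows hz, rows hw, rows' hx, rows' hy,
      rows' hz, rows' hw] at hd
    obtain ⟨⟨⟨⟨h1, h1'⟩, h2, h2'⟩, h3, h3'⟩, ⟨h4, h5⟩, h6, h7⟩ := hd
    refine ChainFree.not_insert_insert (l := [φ ⟨x, hx⟩, φ ⟨y, hy⟩, φ ⟨z, hz⟩, φ ⟨w, hw⟩]) hr h ?_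
      hrel ?_ ?_ ?_ ?_ ?_
    · simp [arcs hx hy hxy, arcs hx hz hxz, arcs hy hz hyz, arcs hx hw hxw, arcs hy hw hyw,
        arcs hz hw hzw]
    · simp [c.out_ne_inn hr]
    · simp [c.out_ne_inn hr]
    · simp only [List.pairwise_cons, List.mem_cons, forall_eq_or_imp, List.not_mem_nil,
        false_imp_iff, implies_true, and_true, List.Pairwise.nil]
      exact ⟨⟨h1, h2 ∘ h1, h3 ∘ h2 ∘ h1⟩, ⟨h2, h3 ∘ h2⟩, h3⟩
    · simp only [List.pairwise_cons, List.mem_cons, forall_eq_or_imp, List.not_mem_nil,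
        false_imp_iff, implies_true, and_true, List.Pairwise.nil]
      exact ⟨⟨h1', h2' ∘ h1', h3' ∘ h2' ∘ h1'⟩, ⟨h2', h3' ∘ h2'⟩, h3'⟩
    · simp only [List.mem_cons, forall_eq_or_imp, List.not_mem_nil, false_imp_iff, implies_true,
        and_true]
      exact ⟨h4, h5, h6, h7⟩

theorem circ13_lt : ∀ row ∈ circ13, row < 2 ^ 32 := by decide

theorem hasChainIn_eq_false (c : Config r v φ χ N)
    (h : ChainFree r 6 Set.univ) (b : Fin 12) : hasChainIn circ13 4 (N b) = false := by
  rw [← Bool.not_eq_true, hasChainIn_iff (by decide) circ13_lt _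
    ((c.lt b).trans (by decide))]
  rintro ⟨l, hl, hN, hp⟩
  have hlt : ∀ x ∈ l, x < 12 := by
    intro x hx
    by_contra! hx'
    have := Nat.testBit_lt_two_pow ((c.lt b).trans_le
      (Nat.pow_le_pow_right two_pos hx' : 2 ^ 12 ≤ 2 ^ x))
    simp [hN x hx] at this
  refine h (χ b :: v :: l.pmap (fun x hx => φ ⟨x, hx⟩) hlt) (by simp [hl]) ?_ fun _ _ =>
    Set.mem_univ _
  simp only [List.pairwise_cons, List.mem_cons, forall_eq_or_imp, List.mem_pmap,
    List.pairwise_pmap]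
  refine ⟨⟨c.inn b, ?_⟩, ?_, hp.imp fun hxy hx hy => (c.realizes_out ⟨_, hx⟩ ⟨_, hy⟩).2 hxy⟩
  · rintro _ ⟨x, hx, rfl⟩
    exact (c.row b ⟨x, hlt x hx⟩).1 (hN x hx)
  · rintro _ ⟨x, hx, rfl⟩
    exact c.out _

end Config

end

section

variable {V : Type u} {r : V → V → Prop} {v : V} {φ χ : Fin 12 → V} {N : ℕ → ℕ}

theorem count_eq_card (M : ℕ) :
    count M = (Finset.univ.filter fun i : Fin 12 => M.testBit i = true).card := by
  have h : ∀ n : ℕ, Nat.rec (motive := fun _ => ℕ) 0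
      (fun i ih => Nat.add ih (Nat.mod (Nat.shiftRight M i) 2)) n =
        ∑ i ∈ Finset.range n, (M.testBit i).toNat := by
    intro n
    induction n with
    | zero => rfl
    | succ n ih =>
      rw [Finset.sum_range_succ, ← ih, Nat.toNat_testBit, ← Nat.shiftRight_eq_div_pow]
      rfl
  rw [count, h, Finset.sum_range, Finset.card_filter]
  refine Finset.sum_congr rfl fun i _ => ?_
  cases M.testBit i <;> rfl

theorem sel_lt (b : Bool) : sel b 1 0 < 2 ^ 1 := by
  cases b <;> decide

theorem testBit_concat_sel (p : ℕ → Bool) (n i : ℕ) :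
    (concat 1 (fun i => sel (p i) 1 0) n).testBit i = (decide (i < n) && p i) := by
  have := testBit_concat (n := n) (fun i _ => sel_lt (p i)) i one_pos
  rw [one_mul, add_zero] at this
  rw [this]
  cases p i <;> simp

theorem concat_sel_lt (p : ℕ → Bool) (n : ℕ) :
    concat 1 (fun i => sel (p i) 1 0) n < 2 ^ n := by
  simpa using concat_lt (n := n) fun i _ => sel_lt (p i)

namespace Config

/-- The vertices named by a configuration. -/
def vertex (v : V) (φ χ : Fin 12 → V) : Fin 12 ⊕ Fin 12 ⊕ Unit → V :=
  Sum.elim φ (Sum.elim χ fun _ => v)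

theorem injective_vertex (c : Config r v φ χ N) (hr : IsTournament r) :
    Function.Injective (vertex v φ χ) := by
  refine c.injective_out.sumElim (c.injective_inn.sumElim (fun _ _ _ => rfl) ?_) ?_
  · exact fun b _ => hr.ne_of_rel (c.inn b)
  · rintro i (b | _)
    exacts [(c.out_ne_inn hr i b).symm, (hr.ne_of_rel (c.out i)).symm]

theorem bijective_vertex (c : Config r v φ χ N) (hr : IsTournament r) [Fintype V]
    (hV : Fintype.card V = 25) : Function.Bijective (vertex v φ χ) :=
  (Fintype.bijective_iff_injective_and_card _).2 ⟨c.injective_vertex hr, by simp [hV]⟩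

theorem card_out_inn (c : Config r v φ χ N) (hr : IsTournament r) [Fintype V] [DecidableRel r]
    (hV : Fintype.card V = 25) (b : Fin 12) :
    (Finset.univ.filter fun w => r (χ b) w).card =
      count (N b) + count (circ13.getD b 0) + 1 := by
  rw [Finset.card_filter, ← (c.bijective_vertex hr hV).sum_comp, Fintype.sum_sum_type,
    Fintype.sum_sum_type, count_eq_card, count_eq_card, Finset.card_filter, Finset.card_filter,
    ← add_assoc]
  simp only [vertex, Sum.elim_inl, Sum.elim_inr, c.inn, c.row, Finset.sum_const, if_true,
    c.realizes_inn b _]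
  rfl

/-- The permutation `x ↦ 3 x + 2` of the indices of `circ13` that fixes the last one. -/
def turn (i : Fin 12) : Fin 12 :=
  ⟨(3 * i + 2) % 13, by revert i; decide⟩

theorem testBit_rot (M : ℕ) (i : Fin 12) : (rot M).testBit i = M.testBit (turn i) := by
  rw [rot, testBit_concat_sel, decide_eq_true i.2, Bool.true_and, bit_eq]
  rfl

theorem rot_lt (M : ℕ) : rot M < 4096 := concat_sel_lt _ 12

theorem turn_config (c : Config r v φ χ N) :
    Config r v (φ ∘ turn) χ fun b => rot (N b) where
  out _ := c.out _
  inn := c.inn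
  injective_out := c.injective_out.comp (by decide)
  injective_inn := c.injective_inn
  realizes_out i j := by
    have h : ∀ i j : Fin 12, (circ13.getD (turn i) 0).testBit (turn j) =
        (circ13.getD i 0).testBit j := by decide
    rw [← h i j]
    exact c.realizes_out _ _
  realizes_inn := c.realizes_inn
  lt _ := rot_lt _
  row b i := by
    rw [testBit_rot]
    exact c.row b _

theorem canon_or {M : ℕ} (hM : M < 4096) :
    canon M = true ∨ canon (rot M) = true ∨ canon (rot (rot M)) = true := by
  have h : ((List.range 4096).all fun M =>
      canon M || (canon (rot M) || canon (rot (rot M)))) = true := by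
    decide +kernel
  have := List.all_eq_true.1 h M (List.mem_range.2 hM)
  simpa only [Bool.or_eq_true] using this

end Config

end

theorem run_canonBetween_0_300 : run (canonBetween 0 300) = true := by decide +kernel

theorem run_canonBetween_300_600 : run (canonBetween 300 600) = true := by decide +kernel

theorem run_canonBetween_600_1000 : run (canonBetween 600 1000) = true := by decide +kernel

theorem run_canonBetween_1000_4096 : run (canonBetween 1000 4096) = true := by decide +kernel

section

variable {V : Type u} {r : V → V → Prop} {v : V} {φ χ : Fin 12 → V} {N : ℕ → ℕ}

theorem blt_eq_decide (a b : ℕ) : Nat.blt a b = decide (a < b) := by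
  rw [Bool.eq_iff_iff, decide_eq_true_iff]
  exact iff_of_eq Nat.ble_eq

namespace Config

theorem relabel {N' : ℕ → ℕ} (c : Config r v φ χ N) (h : ∀ b < 12, N' b = N b) :
    Config r v φ χ N' where
  out := c.out
  inn := c.inn
  injective_out := c.injective_out
  injective_inn := c.injective_inn
  realizes_out := c.realizes_out
  realizes_inn := c.realizes_inn
  lt b := by rw [h b b.2]; exact c.lt b
  row b i := by rw [h b b.2]; exact c.row b i

/-- The vertices named by a configuration, in the order used by `glue`. -/
def vertexFin (v : V) (φ χ : Fin 12 → V) (i : Fin 25) : V :=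
  if h : (i : ℕ) < 12 then φ ⟨i, h⟩ else if h' : (i : ℕ) < 24 then χ ⟨i - 12, by omega⟩ else v

theorem realizes_glue (c : Config r v φ χ N) (hr : IsTournament r) :
    Realizes r (vertexFin v φ χ) (glue N) := by
  intro i j
  have hglue : ((glue N).getD i 0).testBit j = glueArc N i j := by
    rw [glue, List.getD_eq_getElem _ _ (by simp), List.getElem_map, List.getElem_range,
      testBit_concat_sel, decide_eq_true j.2, Bool.true_and]
  have hblt : ∀ {a b : ℕ} (p q : Bool), sel (Nat.blt a b) p q = if a < b then p else q := by
    intro a b p q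
    rw [blt_eq_decide]
    by_cases h : a < b <;> simp [h]
  rw [hglue, glueArc]
  simp only [hblt, vertexFin]
  have hi := i.2
  have hj := j.2
  by_cases hi1 : (i : ℕ) < 12
  · by_cases hj1 : (j : ℕ) < 12
    · simp only [hi1, hj1, dite_true, if_true]
      exact c.rel_out_iff _ _
    · by_cases hj2 : (j : ℕ) < 24
      · simp only [hi1, hj1, hj2, dite_true, if_true, dite_false, if_false, nat_ops]
        rw [bit_eq, Bool.not_eq_true', ← Bool.not_eq_true, ← hr.not_rel_iff (c.out_ne_inn hr _ _)]
        exact not_congr (c.row ⟨j - 12, by omega⟩ ⟨i, hi1⟩).symm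
      · simp only [hi1, hj1, hj2, dite_true, if_true, dite_false, if_false]
        simpa using hr.asymm (c.out _)
  · by_cases hi2 : (i : ℕ) < 24
    · by_cases hj1 : (j : ℕ) < 12
      · simp only [hi1, hi2, hj1, dite_true, if_true, dite_false, if_false, nat_ops]
        rw [bit_eq]
        exact (c.row ⟨i - 12, by omega⟩ ⟨j, hj1⟩).symm
      · by_cases hj2 : (j : ℕ) < 24
        · simp only [hi1, hi2, hj1, hj2, dite_true, if_true, dite_false, if_false, nat_ops]
          exact c.rel_inn_iff _ _
        · simp only [hi1, hi2, hj1, hj2, dite_true, if_true, dite_false, if_false]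
          simpa using c.inn _
    · by_cases hj1 : (j : ℕ) < 12
      · rw [blt_eq_decide, decide_eq_true hj1]
        simp only [hi1, hi2, hj1, dite_true, dite_false, if_false]
        simpa using c.out _
      · rw [blt_eq_decide, decide_eq_false hj1]
        by_cases hj2 : (j : ℕ) < 24
        · simp only [hi1, hi2, hj1, hj2, dite_true, dite_false, if_false]
          simpa using hr.asymm (c.inn _)
        · simp only [hi1, hi2, hj1, hj2, dite_false, if_false]
          simpa using hr.1 v

theorem hasChain_glue (c : Config r v φ χ N) (hr : IsTournament r)
    (h : ChainFree r 6 Set.univ) : hasChain (glue N) 6 = false := by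
  have hlt : ∀ row ∈ glue N, row < 2 ^ 25 := by
    intro row hrow
    obtain ⟨i, -, rfl⟩ := List.mem_map.1 hrow
    exact concat_sel_lt _ 25
  exact (isModel_ofFn (c.realizes_glue hr) (by simp [glue]) hlt).hasChain_eq_false (by simp)
    (fun _ _ => Set.mem_univ _) h

theorem mem_paleyRows_of_leaf (c : Config r v φ χ N) (hr : IsTournament r)
    (h : ChainFree r 6 Set.univ) (hleaf : leaf (order.map N).reverse = true) {b : ℕ}
    (hb : b < 12) : N b ∈ paleyRows := by
  have hpos : ∀ b < 12, (order.map N).reverse.getD (position.getD b 0) 0 = N b := by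
    intro b hb
    interval_cases b <;> rfl
  have horder : ∀ b < 12, b ∈ order := by decide
  rw [leaf, (c.relabel hpos).hasChain_glue hr h] at hleaf
  cases hall : (order.map N).reverse.all fun N => paleyRows.any fun M => Nat.beq M N with
  | false => simp [hall] at hleaf
  | true =>
    have := List.all_eq_true.1 hall (N b)
      (List.mem_reverse.2 (List.mem_map.2 ⟨b, horder b hb, rfl⟩))
    obtain ⟨M, hM, he⟩ := List.any_eq_true.1 this
    rwa [← Nat.eq_of_beq_eq_true he]

theorem mem_paleyRows_of_canon [Fintype V] [DecidableRel r] (c : Config r v φ χ N)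
    (hr : IsTournament r) (h : ChainFree r 6 Set.univ) (hV : Fintype.card V = 25)
    (hdeg : ∀ w, 11 ≤ (Finset.univ.filter fun x => r w x).card ∧
      (Finset.univ.filter fun x => r w x).card ≤ 13)
    (hcanon : canon (N 6) = true) {b : ℕ} (hb : b < 12) : N b ∈ paleyRows := by
  have hcount : ∀ b < 12, 10 ≤ count (N b) + count (circ13.getD b 0) ∧
      count (N b) + count (circ13.getD b 0) ≤ 12 := by
    intro b hb
    have h1 := hdeg (χ ⟨b, hb⟩)
    rw [c.card_out_inn hr hV] at h1
    dsimp only at h1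
    omega
  have hcirc : ∀ b < 12, 5 ≤ count (circ13.getD b 0) ∧ count (circ13.getD b 0) ≤ 6 := by
    decide +kernel
  have hN : ∀ b < 12, N b ∈ rowList := by
    intro b hb
    have h1 := hcount b hb
    have h2 := hcirc b hb
    exact mem_rowList.2 ⟨c.lt ⟨b, hb⟩, by omega, by omega, c.hasChainIn_eq_false h ⟨b, hb⟩⟩
  have hrun : ∀ {lo hi : ℕ}, run (canonBetween lo hi) = true → lo ≤ N 6 → N 6 < hi →
      N b ∈ paleyRows := by
    intro lo hi hrun hlo hhi
    refine c.mem_paleyRows_of_leaf hr h (run_sound hrun hN hcount (fun b hb x hx =>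
      c.clash_eq_false hr h hb hx) ?_) hb
    rw [canonBetween, hcanon, sel_true, Nat.ble_eq_true_of_le hlo, sel_true,
      blt_eq_decide, decide_eq_true hhi]
  have h6 := c.lt 6
  by_cases h1 : N 6 < 300
  · exact hrun run_canonBetween_0_300 (Nat.zero_le _) h1
  by_cases h2 : N 6 < 600
  · exact hrun run_canonBetween_300_600 (not_lt.1 h1) h2
  by_cases h3 : N 6 < 1000
  · exact hrun run_canonBetween_600_1000 (not_lt.1 h2) h3
  · exact hrun run_canonBetween_1000_4096 (not_lt.1 h3) h6

theorem exists_mem_paleyRows [Fintype V] [DecidableRel r] (c : Config r v φ χ N)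
    (hr : IsTournament r) (h : ChainFree r 6 Set.univ) (hV : Fintype.card V = 25)
    (hdeg : ∀ w, 11 ≤ (Finset.univ.filter fun x => r w x).card ∧
      (Finset.univ.filter fun x => r w x).card ≤ 13) :
    ∃ φ' N', Config r v φ' χ N' ∧ ∀ b < 12, N' b ∈ paleyRows := by
  rcases canon_or (c.lt 6) with h1 | h1 | h1
  · exact ⟨_, _, c, fun b => c.mem_paleyRows_of_canon hr h hV hdeg h1⟩
  · exact ⟨_, _, c.turn_config, fun b => c.turn_config.mem_paleyRows_of_canon hr h hV hdeg h1⟩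
  · exact ⟨_, _, c.turn_config.turn_config, fun b =>
      c.turn_config.turn_config.mem_paleyRows_of_canon hr h hV hdeg h1⟩

end Config

end

section

variable {V : Type u} {r : V → V → Prop} {v : V} {φ χ : Fin 12 → V} {N : ℕ → ℕ}

/-- The rows of a tournament on 27 vertices: a vertex, its thirteen out-neighbours, which form
`circ13`, and its thirteen in-neighbours, with the rows `paleyRows` to twelve out-neighbours. -/
def paley27 : List ℕ :=
  [16382, 87835868, 21989816, 44913520, 77047520, 66129346, 81419140, 55899912, 74051090,
    27712550, 37468236, 115749018, 118710582, 130581102, 47983669, 72702059, 51276483, 12116395,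
    90846561, 120625841, 94710541, 29487317, 26940955, 101553543, 109235545, 7766871, 40060589]

/-- The relation with rows `paley27`. -/
def paleyRel (i j : Fin 27) : Prop := (paley27.getD i 0).testBit j = true

theorem isTournament_paleyRel : IsTournament paleyRel := by
  have h1 : ∀ i : Fin 27, (paley27.getD i 0).testBit i = false := by decide +kernel
  have h2 : ∀ i j : Fin 27, i ≠ j →
      (paley27.getD i 0).testBit j = !(paley27.getD j 0).testBit i := by decide +kernel
  refine ⟨fun i => by rw [paleyRel, h1]; decide, fun i j hij => ?_⟩
  rw [paleyRel, paleyRel, h2 i j hij]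
  cases (paley27.getD j 0).testBit i
  · exact Or.inl ⟨rfl, by decide⟩
  · exact Or.inr ⟨rfl, by decide⟩

theorem not_hasTT_paleyRel : ¬ HasTT paleyRel 6 := by
  rintro ⟨f, -, hf⟩
  have h : hasChainIn paley27 6 (2 ^ 27 - 1) = false := by decide +kernel
  rw [← Bool.not_eq_true, hasChainIn_iff (by decide) (by decide) _ (by decide)] at h
  refine h ⟨List.ofFn fun i => (f i : ℕ), by simp, ?_, List.pairwise_ofFn.2 fun i j => hf i j⟩
  intro x hx
  obtain ⟨i, rfl⟩ := List.mem_ofFn.1 hx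
  rw [Nat.testBit_two_pow_sub_one]
  exact decide_eq_true (f i).2

/-- The indices of twelve out-neighbours in `paley27`. -/
def outIndex (i : Fin 12) : Fin 27 := ⟨1 + i, by omega⟩

/-- The indices of the in-neighbours in `paley27`. -/
def inIndex (k : Fin 13) : Fin 27 := ⟨14 + k, by omega⟩

theorem paleyRel_out_out : ∀ i j : Fin 12, arc i j = true →
    paleyRel (outIndex i) (outIndex j) := by
  unfold paleyRel
  decide +kernel

theorem paleyRel_zero_out : ∀ i : Fin 12, paleyRel 0 (outIndex i) := by
  unfold paleyRel
  decide +kernel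

theorem paleyRel_in_zero : ∀ k : Fin 13, paleyRel (inIndex k) 0 := by
  unfold paleyRel
  decide +kernel

theorem paleyRel_in_out : ∀ (k : Fin 13) (i : Fin 12),
    (paleyRows.getD k 0).testBit i = true → paleyRel (inIndex k) (outIndex i) := by
  unfold paleyRel
  decide +kernel

theorem paleyRel_out_in : ∀ (k : Fin 13) (i : Fin 12),
    (paleyRows.getD k 0).testBit i = false → paleyRel (outIndex i) (inIndex k) := by
  unfold paleyRel
  decide +kernel

theorem paleyRel_in_in : ∀ k k' : Fin 13,
    clash (paleyRows.getD k 0).testBit (paleyRows.getD k' 0).testBit = false →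
      paleyRel (inIndex k) (inIndex k') := by
  unfold paleyRel
  decide +kernel

theorem chainFree_of_not_hasTT (hr : IsTournament r) {k : ℕ} (h : ¬ HasTT r k) :
    ChainFree r k Set.univ := by
  rintro l rfl hp -
  have hrel : ∀ i j : Fin l.length, i < j → r (l.get i) (l.get j) := List.pairwise_iff_get.1 hp
  refine h ⟨l.get, fun i j hij => ?_, hrel⟩
  by_contra hne
  rcases lt_or_gt_of_ne hne with hlt | hlt
  · exact hr.ne_of_rel (hrel i j hlt) hij
  · exact hr.ne_of_rel (hrel j i hlt) hij.symm

theorem injective_of_rel {W : Type*} {s : W → W → Prop} (hr : IsTournament r)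
    (hs : IsTournament s) {g : V → W} (hg : ∀ u v, r u v → s (g u) (g v)) :
    Function.Injective g := by
  intro u w huw
  by_contra hne
  rcases hr.2 u w hne with h | h
  · exact hs.ne_of_rel (hg _ _ h.1) huw
  · exact hs.ne_of_rel (hg _ _ h.1) huw.symm

namespace Config

theorem exists_embedding [Fintype V] (c : Config r v φ χ N) (hr : IsTournament r)
    (h : ChainFree r 6 Set.univ) (hV : Fintype.card V = 25)
    (hN : ∀ b < 12, N b ∈ paleyRows) :
    ∃ g : V → Fin 27, Function.Injective g ∧ ∀ u w, r u w → paleyRel (g u) (g w) := by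
  have hidx : ∀ b : Fin 12, ∃ k : Fin 13, paleyRows.getD k 0 = N b := by
    intro b
    obtain ⟨k, hk, he⟩ := List.getElem_of_mem (hN b b.2)
    exact ⟨⟨k, hk⟩, by rw [List.getD_eq_getElem _ _ hk, he]⟩
  choose ρ hρ using hidx
  let e := Equiv.ofBijective _ (c.bijective_vertex hr hV)
  let τ : Fin 12 ⊕ Fin 12 ⊕ Unit → Fin 27 :=
    Sum.elim outIndex (Sum.elim (fun b => inIndex (ρ b)) fun _ => 0)
  have hτ : ∀ x y, r (e x) (e y) → paleyRel (τ x) (τ y) := by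
    rintro (i | b | _) (j | b' | _) hxy
    · exact paleyRel_out_out i j ((c.rel_out_iff i j).1 hxy)
    · refine paleyRel_out_in (ρ b') i ?_
      rw [hρ, ← Bool.not_eq_true, c.row]
      exact hr.asymm hxy
    · exact absurd hxy (hr.asymm (c.out i))
    · refine paleyRel_in_out (ρ b) j ?_
      rw [hρ, c.row]
      exact hxy
    · refine paleyRel_in_in (ρ b) (ρ b') ?_
      rw [hρ, hρ]
      exact c.clash_eq_false hr h b.2 b'.2 ((c.rel_inn_iff b b').1 hxy)
    · exact paleyRel_in_zero (ρ b)
    · exact paleyRel_zero_out j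
    · exact absurd hxy (hr.asymm (c.inn b'))
    · exact absurd hxy (hr.1 v)
  have hg : ∀ u w, r u w → paleyRel (τ (e.symm u)) (τ (e.symm w)) := by
    intro u w huw
    refine hτ _ _ ?_
    rwa [e.apply_symm_apply, e.apply_symm_apply]
  exact ⟨_, injective_of_rel hr isTournament_paleyRel hg, hg⟩

end Config

theorem exists_config [Fintype V] [DecidableRel r] (hr : IsTournament r)
    (h : ChainFree r 6 Set.univ)
    (hout : 12 ≤ (Finset.univ.filter fun w => r v w).card)
    (hinn : 12 ≤ (Finset.univ.filter fun w => r w v).card) :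
    ∃ φ χ N, Config r v φ χ N := by
  have hO : ChainFree r 5 (Finset.univ.filter fun w => r v w : Finset V) :=
    (h.out (Set.mem_univ v)).mono (by intro w; simp)
  have hI : ChainFree r 5 (Finset.univ.filter fun w => r w v : Finset V) :=
    (h.inn (Set.mem_univ v)).mono (by intro w; simp)
  obtain ⟨φ, hφ, hφi, hφr⟩ := exists_realizes_circ13 hr hout hO
  obtain ⟨χ, hχ, hχi, hχr⟩ := exists_realizes_circ13 hr hinn hI
  have hrow : ∀ b : ℕ, ∃ m, ∀ hb : b < 12, IsRow r m (χ ⟨b, hb⟩) (List.ofFn φ) := by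
    intro b
    by_cases hb : b < 12
    · obtain ⟨m, hm⟩ := exists_isRow r (χ ⟨b, hb⟩) (List.ofFn φ)
      exact ⟨m, fun _ => hm⟩
    · exact ⟨0, fun hb' => absurd hb' hb⟩
  choose N hN using hrow
  refine ⟨φ, χ, N, fun i => (Finset.mem_filter.1 (hφ i)).2, fun b => (Finset.mem_filter.1 (hχ b)).2,
    hφi, hχi, hφr, hχr, fun b => by simpa using (hN b b.2).lt, fun b i => ?_⟩
  rw [hN b b.2 i]
  simp [-List.ofFn_succ]

theorem exists_embedding_paleyRel [Fintype V] (hV : Fintype.card V = 25) (hr : IsTournament r)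
    (h : ChainFree r 6 Set.univ) :
    ∃ g : V → Fin 27, Function.Injective g ∧ ∀ u w, r u w → paleyRel (g u) (g w) := by
  classical
  have hsum : ∀ w, (Finset.univ.filter fun x => r w x).card +
      (Finset.univ.filter fun x => r x w).card = 24 := by
    intro w
    have := card_out_add_card_in hr (Finset.mem_univ w)
    rw [Finset.card_univ, hV] at this
    omega
  have hout : ∀ w, (Finset.univ.filter fun x => r w x).card ≤ 13 := fun w =>
    card_le_of_chainFree hr ((h.out (Set.mem_univ w)).mono (by intro w; simp))
  have hinn : ∀ w, (Finset.univ.filter fun x => r x w).card ≤ 13 := fun w =>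
    card_le_of_chainFree hr ((h.inn (Set.mem_univ w)).mono (by intro w; simp))
  have hdeg : ∀ w, 11 ≤ (Finset.univ.filter fun x => r w x).card ∧
      (Finset.univ.filter fun x => r w x).card ≤ 13 := by
    intro w
    have h1 := hsum w
    have h2 := hout w
    have h3 := hinn w
    omega
  obtain ⟨v, hv⟩ : ∃ v, (Finset.univ.filter fun x => r v x).card = 12 := by
    by_contra! hne
    have hodd : ∀ w ∈ Finset.univ, Odd (Finset.univ.filter fun x => r w x).card := by
      intro w _
      have h1 := hdeg w
      have h2 := hne w
      rw [Nat.odd_iff]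
      omega
    have h1 := Finset.odd_sum_iff_odd_card_odd (s := Finset.univ)
      (fun w => (Finset.univ.filter fun x => r w x).card)
    rw [Finset.filter_true_of_mem hodd, Finset.card_univ, hV] at h1
    have h2 := sum_card_out hr Finset.univ
    rw [Finset.card_univ, hV] at h2
    have h3 := h1.2 (by decide)
    rw [Nat.odd_iff] at h3
    omega
  obtain ⟨φ, χ, N, c⟩ := exists_config hr h hv.ge (by have := hsum v; omega)
  obtain ⟨φ', N', c', hN'⟩ := c.exists_mem_paleyRows hr h hV hdeg
  exact c'.exists_embedding hr h hV hN'

end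

end TournamentExtension

theorem TT6_free_25_subtournament_of_27 :
    ∀ r : Fin 25 → Fin 25 → Prop, IsTournament r → ¬ HasTT r 6 →
      ∃ s : Fin 27 → Fin 27 → Prop, IsTournament s ∧ ¬ HasTT s 6 ∧
        ∃ g : Fin 25 → Fin 27, Function.Injective g ∧
          ∀ u v : Fin 25, r u v → s (g u) (g v) := by
  intro r hr h
  exact ⟨TournamentExtension.paleyRel, TournamentExtension.isTournament_paleyRel,
    TournamentExtension.not_hasTT_paleyRel,
    TournamentExtension.exists_embedding_paleyRel (by simp) hr
      (TournamentExtension.chainFree_of_not_hasTT hr h)⟩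
end
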